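/- arXiv:0706.3221 — 3 statements merged into one kernel-verified Lean document; each statement's English description precedes it below -/
import Mathlib

section
/- Let f : Ω → ℝ³ be a smooth non-degenerate conjugate net, let (u₀, v₀) ∈ Ω be a point at which the second fundamental form does not vanish (i.e. (f_uu · N, f_vv · N) ≠ (0, 0), where N is the unit normal), and for ε > 0 set A = f(u₀, v₀), B = f(u₀ + ε, v₀), C = f(u₀, v₀ + ε), D = f(u₀ + ε, v₀ + ε) and let π_ABC be the plane through A, B, C. Then there exist constants C₀ > 0 and ε₀ > 0 such that for every 0 < ε < ε₀ there is a point M lying both on π_ABC and in the image f(Ω) with ‖M − D‖ ≤ C₀ ε³. -/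
open Metric

noncomputable section

/-- Euclidean three-space. -/
abbrev E3 : Type := EuclideanSpace ℝ (Fin 3)

/-- The dot product in `ℝ³`. -/
def dot3 (x y : E3) : ℝ := x 0 * y 0 + x 1 * y 1 + x 2 * y 2

/-- The cross product in `ℝ³`. -/
def cross3 (x y : E3) : E3 :=
  (WithLp.equiv 2 (Fin 3 → ℝ)).symm
    ![x 1 * y 2 - x 2 * y 1, x 2 * y 0 - x 0 * y 2, x 0 * y 1 - x 1 * y 0]

/-- Partial derivative in the first coordinate direction. -/
def pd1 (f : ℝ × ℝ → E3) (p : ℝ × ℝ) : E3 := fderiv ℝ f p (1, 0)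

/-- Partial derivative in the second coordinate direction. -/
def pd2 (f : ℝ × ℝ → E3) (p : ℝ × ℝ) : E3 := fderiv ℝ f p (0, 1)

/-- The unit normal of a parametrized surface. -/
def unitNormal (f : ℝ × ℝ → E3) (p : ℝ × ℝ) : E3 :=
  ‖cross3 (pd1 f p) (pd2 f p)‖⁻¹ • cross3 (pd1 f p) (pd2 f p)

/-- The scalar triple product on `ℝ³`. -/
def triple (x y z : E3) : ℝ := dot3 z (cross3 x y)

lemma triple_eq (x y z : E3) : triple x y z =
    z 0 * (x 1 * y 2 - x 2 * y 1) + z 1 * (x 2 * y 0 - x 0 * y 2)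
      + z 2 * (x 0 * y 1 - x 1 * y 0) := by
  simp [triple, dot3, cross3]

lemma abs_triple_le (x y z : E3) : |triple x y z| ≤ 6 * (‖x‖ * ‖y‖ * ‖z‖) := by
  have key : ∀ i j k : Fin 3, |x i * y j * z k| ≤ ‖x‖ * ‖y‖ * ‖z‖ := by
    intro i j k
    rw [abs_mul, abs_mul]
    have hx : |x i| ≤ ‖x‖ := PiLp.norm_apply_le x i
    have hy : |y j| ≤ ‖y‖ := PiLp.norm_apply_le y j
    have hz : |z k| ≤ ‖z‖ := PiLp.norm_apply_le z k
    gcongr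
  have h1 := abs_le.1 (key 1 2 0)
  have h2 := abs_le.1 (key 2 1 0)
  have h3 := abs_le.1 (key 2 0 1)
  have h4 := abs_le.1 (key 0 2 1)
  have h5 := abs_le.1 (key 0 1 2)
  have h6 := abs_le.1 (key 1 0 2)
  rw [triple_eq, abs_le]
  constructor <;> linarith [h1.1, h1.2]

lemma triple_cramer (x y z w : E3) :
    triple x y w • z = triple z y w • x + triple x z w • y + triple x y z • w := by
  ext i
  fin_cases i <;> simp [triple_eq] <;> ring

lemma triple_combination (x y z w : E3) (c d e : ℝ) :
    triple x y (c • x + d • y + e • z + w) = e * triple x y z + triple x y w := by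
  simp [triple_eq]; ring

lemma triple_add_smul_left_right (x y z ξ η : E3) (ε : ℝ) :
    triple (ε • x + ξ) (ε • y + η) z =
      ε ^ 2 * triple x y z + (ε * triple x η z + ε * triple ξ y z + triple ξ η z) := by
  simp [triple_eq]; ring

lemma continuous_triple (x y : E3) : Continuous fun z => triple x y z := by
  simp only [triple_eq]
  fun_prop

lemma mem_affineSpan_of_triple_eq_zero {A B C M w : E3}
    (hw : triple (B - A) (C - A) w ≠ 0) (hM : triple (B - A) (C - A) (M - A) = 0) :
    M ∈ affineSpan ℝ ({A, B, C} : Set E3) := by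
  have h := triple_cramer (B - A) (C - A) (M - A) w
  rw [hM, zero_smul, add_zero] at h
  set τ := triple (B - A) (C - A) w
  set c := triple (M - A) (C - A) w
  set d := triple (B - A) (M - A) w
  have hz : M = ((τ⁻¹ * c) • (B - A) + (τ⁻¹ * d) • (C - A)) + A := by
    rw [mul_smul, mul_smul, ← smul_add, ← h, smul_smul, inv_mul_cancel₀ hw]; simp
  have hA : A ∈ affineSpan ℝ ({A, B, C} : Set E3) := subset_affineSpan ℝ _ (by simp)
  have hB : B ∈ affineSpan ℝ ({A, B, C} : Set E3) := subset_affineSpan ℝ _ (by simp)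
  have hC : C ∈ affineSpan ℝ ({A, B, C} : Set E3) := subset_affineSpan ℝ _ (by simp)
  rw [hz]
  refine AffineSubspace.vadd_mem_of_mem_direction
    (v := (τ⁻¹ * c) • (B - A) + (τ⁻¹ * d) • (C - A)) ?_ hA
  exact add_mem (Submodule.smul_mem _ _ (AffineSubspace.vsub_mem_direction hB hA))
    (Submodule.smul_mem _ _ (AffineSubspace.vsub_mem_direction hC hA))

lemma contDiffAt_pd1 {f : ℝ × ℝ → E3} {p : ℝ × ℝ} (hf : ContDiffAt ℝ (⊤ : ℕ∞) f p) :
    ContDiffAt ℝ (⊤ : ℕ∞) (pd1 f) p :=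
  (hf.fderiv_right (m := (⊤ : ℕ∞)) (by norm_cast)).clm_apply contDiffAt_const

lemma contDiffAt_pd2 {f : ℝ × ℝ → E3} {p : ℝ × ℝ} (hf : ContDiffAt ℝ (⊤ : ℕ∞) f p) :
    ContDiffAt ℝ (⊤ : ℕ∞) (pd2 f) p :=
  (hf.fderiv_right (m := (⊤ : ℕ∞)) (by norm_cast)).clm_apply contDiffAt_const

lemma pd1_pd2_comm {f : ℝ × ℝ → E3} {p : ℝ × ℝ} (hf : ContDiffAt ℝ (⊤ : ℕ∞) f p) :
    pd1 (pd2 f) p = pd2 (pd1 f) p := by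
  have hd : DifferentiableAt ℝ (fderiv ℝ f) p :=
    (hf.fderiv_right (m := 1) (by norm_cast)).differentiableAt (by norm_num)
  have hs : IsSymmSndFDerivAt ℝ f p :=
    hf.isSymmSndFDerivAt (by simp [minSmoothness_of_isRCLikeNormedField]; norm_cast)
  have h1 : ∀ w w' : ℝ × ℝ,
      fderiv ℝ (fun q => fderiv ℝ f q w) p w' = fderiv ℝ (fderiv ℝ f) p w' w := by
    intro w w'
    rw [fderiv_clm_apply hd (differentiableAt_const w)]
    simp
  change fderiv ℝ (fun q => fderiv ℝ f q (0, 1)) p (1, 0) =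
    fderiv ℝ (fun q => fderiv ℝ f q (1, 0)) p (0, 1)
  rw [h1, h1]
  exact hs _ _

lemma fderiv_mk_apply (f : ℝ × ℝ → E3) (p : ℝ × ℝ) (s t : ℝ) :
    fderiv ℝ f p (s, t) = s • pd1 f p + t • pd2 f p := by
  rw [pd1, pd2, ← map_smul, ← map_smul, ← map_add]
  simp

lemma hasDerivAt_comp_add_fst {f : ℝ × ℝ → E3} {u v s : ℝ}
    (hf : DifferentiableAt ℝ f (u + s, v)) :
    HasDerivAt (fun s => f (u + s, v)) (pd1 f (u + s, v)) s :=
  hf.hasFDerivAt.comp_hasDerivAt s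
    (((hasDerivAt_id s).const_add u).prodMk (hasDerivAt_const s v))

lemma hasDerivAt_comp_add_snd {f : ℝ × ℝ → E3} {u v t : ℝ}
    (hf : DifferentiableAt ℝ f (u, v + t)) :
    HasDerivAt (fun t => f (u, v + t)) (pd2 f (u, v + t)) t :=
  hf.hasFDerivAt.comp_hasDerivAt t
    ((hasDerivAt_const t u).prodMk ((hasDerivAt_id t).const_add v))

/-- First-order Taylor expansion with quadratic remainder, uniformly on squares. -/
lemma exists_norm_sub_taylor_le {g : ℝ × ℝ → E3} {u v : ℝ}
    (hg : ContDiffAt ℝ (⊤ : ℕ∞) g (u, v)) :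
    ∃ K ≥ 0, ∃ r > 0, ∀ s t h : ℝ, |s| ≤ h → |t| ≤ h → h < r →
      ‖g (u + s, v + t) - g (u, v) - (s • pd1 g (u, v) + t • pd2 g (u, v))‖ ≤ K * h ^ 2 := by
  obtain ⟨K, U, hU, hK⟩ := (hg.fderiv_right (m := 1) (by norm_cast)).exists_lipschitzOnWith
  have hev : ∀ᶠ q in nhds (u, v), ContDiffAt ℝ 1 g q :=
    (hg.of_le (by norm_cast)).eventually (by simp)
  obtain ⟨r, hr, hball⟩ := Metric.mem_nhds_iff.1 (Filter.inter_mem hU hev)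
  refine ⟨K, K.2, r, hr, fun s t h hs ht hh => ?_⟩
  have h0 : 0 ≤ h := (abs_nonneg s).trans hs
  have hsub : closedBall (u, v) h ⊆ ball (u, v) r := closedBall_subset_ball hh
  have hmem : (u + s, v + t) ∈ closedBall (u, v) h := by
    simp [mem_closedBall, Prod.dist_eq, hs, ht]
  have hmem0 : (u, v) ∈ closedBall (u, v) h := mem_closedBall_self h0
  have := (convex_closedBall (u, v) h).norm_image_sub_le_of_norm_fderiv_le'
    (f := g) (φ := fderiv ℝ g (u, v)) (C := K * h) (𝕜 := ℝ)
    (fun q hq =>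
      (show ContDiffAt ℝ 1 g q from (hball (hsub hq)).2).differentiableAt one_ne_zero)
    (fun q hq => by
      have := hK.dist_le_mul q (hball (hsub hq)).1 (u, v) (hball (hsub hmem0)).1
      rw [dist_eq_norm] at this
      exact this.trans (mul_le_mul_of_nonneg_left hq K.2)) hmem0 hmem
  have hd : ((u + s, v + t) : ℝ × ℝ) - (u, v) = (s, t) := by simp
  rw [hd, fderiv_mk_apply] at this
  refine this.trans ?_
  have hn : ‖(s, t)‖ ≤ h := by simp [Prod.norm_def, hs, ht]
  calc (K : ℝ) * h * ‖(s, t)‖ ≤ K * h * h := by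
        have := K.2
        gcongr
    _ = K * h ^ 2 := by ring

lemma norm_sub_quadratic_le {V : Type*} [NormedAddCommGroup V] [NormedSpace ℝ V]
    {γ γ' : ℝ → V} {x w : V} {C τ : ℝ}
    (hγ : ∀ s ∈ Set.uIcc 0 τ, HasDerivAt γ (γ' s) s)
    (hC : ∀ s ∈ Set.uIcc 0 τ, ‖γ' s - (x + s • w)‖ ≤ C) :
    ‖γ τ - γ 0 - (τ • x + (τ ^ 2 / 2) • w)‖ ≤ C * |τ| := by
  have hd : ∀ s ∈ Set.uIcc 0 τ, HasDerivWithinAt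
      (fun s => γ s - (s • x + (s ^ 2 / 2) • w)) (γ' s - (x + s • w)) (Set.uIcc 0 τ) s := by
    intro s hs
    have h1 : HasDerivAt (fun s : ℝ => s • x) ((1 : ℝ) • x) s := (hasDerivAt_id s).smul_const x
    have h2 : HasDerivAt (fun s : ℝ => (s ^ 2 / 2) • w) (s • w) s := by
      have := ((hasDerivAt_pow 2 s).div_const 2).smul_const w
      convert this using 2
      simp
    rw [one_smul] at h1
    exact ((hγ s hs).sub (h1.add h2)).hasDerivWithinAt
  have := (convex_uIcc 0 τ).norm_image_sub_le_of_norm_hasDerivWithin_le hd hC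
    Set.left_mem_uIcc Set.right_mem_uIcc
  rw [sub_zero, Real.norm_eq_abs] at this
  convert this using 2
  simp
  abel

/-- Eliminating the tangent vectors `x, y` in favour of the edge vectors `P, Q`. -/
lemma exists_combination_bound (x y xx yy : E3) (a b α β K : ℝ) (hK : 0 ≤ K) :
    ∃ K' ≥ 0, ∀ ε t : ℝ, 0 < ε → ε ≤ 1 → |t| ≤ ε ^ 2 → ∀ P Q δ E : E3,
      ‖P - (ε • x + (ε ^ 2 / 2) • xx)‖ ≤ K * ε ^ 3 →
      ‖Q - (ε • y + (ε ^ 2 / 2) • yy)‖ ≤ K * ε ^ 3 →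
      ‖δ - (ε ^ 2 • (a • x + b • y) +
        (ε ^ 3 / 2) • (a • xx + b • yy + α • x + β • y))‖ ≤ K * ε ^ 4 →
      ‖E - (t • (x + ε • xx + ε • (a • x + b • y)) + (t ^ 2 / 2) • xx)‖ ≤ K * ε ^ 2 * |t| →
      ∃ (c d : ℝ) (R : E3), P + Q + δ + E = c • P + d • Q + (t * ε / 2) • xx + R ∧
        ‖R‖ ≤ K' * (ε ^ 4 + |t| * ε ^ 2) := by
  refine ⟨K + K + ‖xx‖ + (2 * |a| + |α|) * K + K + (2 * |b| + |β|) * K + |α| * ‖xx‖ +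
    |β| * ‖yy‖ + |a| * ‖xx‖ + |b| * ‖yy‖, by positivity, ?_⟩
  intro ε t hε hε1 ht P Q δ E hP hQ hδ hE
  obtain ⟨τ, rfl⟩ : ∃ τ, t = τ * ε := ⟨t / ε, by field_simp⟩
  obtain ⟨t, hte⟩ : ∃ t, t = τ * ε := ⟨_, rfl⟩
  set ρ₁ := P - (ε • x + (ε ^ 2 / 2) • xx) with hρ₁
  set ρ₂ := Q - (ε • y + (ε ^ 2 / 2) • yy) with hρ₂
  set ρ₃ := δ - (ε ^ 2 • (a • x + b • y) +
        (ε ^ 3 / 2) • (a • xx + b • yy + α • x + β • y)) with hρ₃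
  set ρ₄ := E - ((τ * ε) • (x + ε • xx + ε • (a • x + b • y)) + ((τ * ε) ^ 2 / 2) • xx) with hρ₄
  refine ⟨1 + ε * a + ε ^ 2 * α / 2 + τ + τ * ε * a, 1 + ε * b + ε ^ 2 * β / 2 + τ * ε * b,
    ρ₃ + ρ₄ + ((τ * ε) ^ 2 / 2) • xx - (ε * a + ε ^ 2 * α / 2 + τ * ε * a) • ρ₁ - τ • ρ₁
      - (ε * b + ε ^ 2 * β / 2 + τ * ε * b) • ρ₂ - (ε ^ 4 / 4 * α) • xx - (ε ^ 4 / 4 * β) • yy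
      - (τ * ε * a * ε ^ 2 / 2) • xx - (τ * ε * b * ε ^ 2 / 2) • yy, ?_, ?_⟩
  · rw [hρ₁, hρ₂, hρ₃, hρ₄]
    module
  · clear_value ρ₁ ρ₂ ρ₃ ρ₄
    rw [← hte] at ht hE ⊢
    set F := ε ^ 4 + |t| * ε ^ 2 with hF
    have ht2 : |t| ^ 2 ≤ |t| * ε ^ 2 := by nlinarith [abs_nonneg t]
    have hε4 : ε ^ 4 ≤ F := le_add_of_nonneg_right (by positivity)
    have htF : |t| * ε ^ 2 ≤ F := le_add_of_nonneg_left (by positivity)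
    have hF0 : 0 ≤ F := by positivity
    have hε2 : ε ^ 2 ≤ ε := by nlinarith
    have hcoef : ∀ c γ : ℝ, |ε * c + ε ^ 2 * γ / 2 + t * c| ≤ ε * (2 * |c| + |γ|) := by
      intro c γ
      have h1 : |ε * c| = ε * |c| := by rw [abs_mul, abs_of_pos hε]
      have h2 : |ε ^ 2 * γ / 2| = ε ^ 2 * |γ| / 2 := by
        rw [abs_div, abs_mul, abs_of_pos (by positivity : 0 < ε ^ 2)]; norm_num
      have h3 : |t * c| ≤ ε * |c| := by
        rw [abs_mul]; exact mul_le_mul_of_nonneg_right (ht.trans hε2) (abs_nonneg c)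
      have h4 : ε ^ 2 * |γ| ≤ ε * |γ| := mul_le_mul_of_nonneg_right hε2 (abs_nonneg γ)
      have h5 : 0 ≤ ε * |γ| := by positivity
      refine (abs_add_three _ _ _).trans ?_
      linarith
    have hlin : ∀ (c γ : ℝ) (ρ : E3), ‖ρ‖ ≤ K * ε ^ 3 →
        ‖(ε * c + ε ^ 2 * γ / 2 + t * c) • ρ‖ ≤ (2 * |c| + |γ|) * K * F := by
      intro c γ ρ hρ
      rw [norm_smul, Real.norm_eq_abs]
      calc _ ≤ ε * (2 * |c| + |γ|) * (K * ε ^ 3) := by gcongr; exact hcoef c γ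
        _ = (2 * |c| + |γ|) * K * ε ^ 4 := by ring
        _ ≤ _ := by gcongr
    have hquart : ∀ (c : ℝ) (w : E3), ‖(ε ^ 4 / 4 * c) • w‖ ≤ |c| * ‖w‖ * F := by
      intro c w
      rw [norm_smul, Real.norm_eq_abs, abs_mul, abs_of_pos (by positivity : 0 < ε ^ 4 / 4)]
      calc _ = |c| * ‖w‖ * (ε ^ 4 / 4) := by ring
        _ ≤ _ := by gcongr; linarith
    have hmix : ∀ (c : ℝ) (w : E3), ‖(t * c * ε ^ 2 / 2) • w‖ ≤ |c| * ‖w‖ * F := by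
      intro c w
      rw [norm_smul, Real.norm_eq_abs, abs_div, abs_mul, abs_mul,
        abs_of_pos (by positivity : 0 < ε ^ 2), abs_two]
      calc _ = |c| * ‖w‖ * (|t| * ε ^ 2 / 2) := by ring
        _ ≤ _ := by gcongr; linarith
    have e3 : ‖ρ₃‖ ≤ K * F := hδ.trans (by gcongr)
    have e4 : ‖ρ₄‖ ≤ K * F := by
      refine hE.trans ?_
      calc _ = K * (|t| * ε ^ 2) := by ring
        _ ≤ _ := by gcongr
    have e5 : ‖(t ^ 2 / 2) • xx‖ ≤ ‖xx‖ * F := by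
      rw [norm_smul, Real.norm_eq_abs, abs_div, abs_pow, abs_two, mul_comm]
      gcongr
      nlinarith [sq_nonneg |t|]
    have e6 : ‖τ • ρ₁‖ ≤ K * F := by
      rw [norm_smul, Real.norm_eq_abs]
      calc _ ≤ |τ| * (K * ε ^ 3) := by gcongr
        _ = K * (|t| * ε ^ 2) := by rw [hte, abs_mul, abs_of_pos hε]; ring
        _ ≤ _ := by gcongr
    refine (norm_sub_le_of_le (norm_sub_le_of_le (norm_sub_le_of_le (norm_sub_le_of_le
      (norm_sub_le_of_le (norm_sub_le_of_le (norm_sub_le_of_le (norm_add_le_of_le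
      (norm_add_le_of_le e3 e4) e5) (hlin a α ρ₁ hP)) e6) (hlin b β ρ₂ hQ)) (hquart α xx))
      (hquart β yy)) (hmix a xx)) (hmix b yy)).trans (le_of_eq ?_)
    ring

/-- The triple product of two edge vectors with a slowly varying third argument. -/
lemma exists_triple_bound (x y xx yy : E3) (K K' : ℝ) (hK : 0 ≤ K) (hK' : 0 ≤ K') :
    ∃ L > 0, ∀ ε : ℝ, 0 < ε → ε ≤ 1 → ∀ P Q : E3,
      ‖P - (ε • x + (ε ^ 2 / 2) • xx)‖ ≤ K * ε ^ 3 →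
      ‖Q - (ε • y + (ε ^ 2 / 2) • yy)‖ ≤ K * ε ^ 3 →
      |triple P Q xx - ε ^ 2 * triple x y xx| ≤ L * ε ^ 3 ∧
      ∀ (c d t : ℝ) (R : E3), ‖R‖ ≤ K' * (ε ^ 4 + |t| * ε ^ 2) →
        |triple P Q (c • P + d • Q + (t * ε / 2) • xx + R) - t * ε ^ 3 / 2 * triple x y xx|
          ≤ L * (ε ^ 6 + |t| * ε ^ 4) := by
  set p := ‖xx‖ + K with hp
  set q := ‖yy‖ + K with hq
  set L₁ := 6 * (‖x‖ * q * ‖xx‖) + 6 * (p * ‖y‖ * ‖xx‖) + 6 * (p * q * ‖xx‖) with hL₁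
  set L₂ := 6 * ((‖x‖ + p) * (‖y‖ + q) * K') with hL₂
  have hp0 : 0 ≤ p := by positivity
  have hq0 : 0 ≤ q := by positivity
  have hL₁0 : 0 ≤ L₁ := by positivity
  have hL₂0 : 0 ≤ L₂ := by positivity
  refine ⟨L₁ + L₂ + 1, by positivity, fun ε hε hε1 P Q hP hQ => ?_⟩
  have hε32 : ε ^ 3 ≤ ε ^ 2 := pow_le_pow_of_le_one hε.le hε1 (by norm_num)
  have hε43 : ε ^ 4 ≤ ε ^ 3 := pow_le_pow_of_le_one hε.le hε1 (by norm_num)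
  have hε2 : ε ^ 2 ≤ ε := by nlinarith
  have hrem : ∀ z zz Z : E3, ‖Z - (ε • z + (ε ^ 2 / 2) • zz)‖ ≤ K * ε ^ 3 →
      ‖Z - ε • z‖ ≤ (‖zz‖ + K) * ε ^ 2 ∧ ‖Z‖ ≤ (‖z‖ + (‖zz‖ + K)) * ε := by
    intro z zz Z hZ
    have h1 : ‖Z - ε • z‖ ≤ (‖zz‖ + K) * ε ^ 2 := by
      have : Z - ε • z = (Z - (ε • z + (ε ^ 2 / 2) • zz)) + (ε ^ 2 / 2) • zz := by abel
      rw [this]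
      refine (norm_add_le_of_le hZ le_rfl).trans ?_
      rw [norm_smul, Real.norm_eq_abs, abs_of_pos (by positivity)]
      have : K * ε ^ 3 ≤ K * ε ^ 2 := by gcongr
      have : 0 ≤ ε ^ 2 * ‖zz‖ := by positivity
      linarith
    refine ⟨h1, ?_⟩
    have : Z = (Z - ε • z) + ε • z := by abel
    rw [this]
    refine (norm_add_le_of_le h1 le_rfl).trans ?_
    rw [norm_smul, Real.norm_eq_abs, abs_of_pos hε]
    have : (‖zz‖ + K) * ε ^ 2 ≤ (‖zz‖ + K) * ε := by gcongr
    linarith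
  obtain ⟨hPd, hPn⟩ := hrem x xx P hP
  obtain ⟨hQd, hQn⟩ := hrem y yy Q hQ
  rw [← hp] at hPd hPn
  rw [← hq] at hQd hQn
  have h1 : |triple P Q xx - ε ^ 2 * triple x y xx| ≤ L₁ * ε ^ 3 := by
    have hPe : P = ε • x + (P - ε • x) := by abel
    have hQe : Q = ε • y + (Q - ε • y) := by abel
    set ξ := P - ε • x
    set η := Q - ε • y
    rw [hPe, hQe, triple_add_smul_left_right, add_sub_cancel_left]
    refine (abs_add_three _ _ _).trans ?_
    rw [abs_mul, abs_mul, abs_of_pos hε]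
    have e1 : ε * |triple x η xx| ≤ ε * (6 * (‖x‖ * (q * ε ^ 2) * ‖xx‖)) := by
      gcongr
      exact (abs_triple_le _ _ _).trans (by gcongr)
    have e2 : ε * |triple ξ y xx| ≤ ε * (6 * ((p * ε ^ 2) * ‖y‖ * ‖xx‖)) := by
      gcongr
      exact (abs_triple_le _ _ _).trans (by gcongr)
    have e3 : |triple ξ η xx| ≤ 6 * (p * q * ‖xx‖) * ε ^ 3 := by
      calc _ ≤ 6 * ((p * ε ^ 2) * (q * ε ^ 2) * ‖xx‖) :=
            (abs_triple_le _ _ _).trans (by gcongr)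
        _ = 6 * (p * q * ‖xx‖) * ε ^ 4 := by ring
        _ ≤ _ := by gcongr
    rw [hL₁]
    linarith
  refine ⟨h1.trans (by gcongr; linarith), fun c d t R hR => ?_⟩
  rw [triple_combination]
  have e1 : |t * ε / 2 * (triple P Q xx - ε ^ 2 * triple x y xx)| ≤ L₁ * (|t| * ε ^ 4) := by
    rw [abs_mul, abs_div, abs_mul, abs_of_pos hε, abs_two]
    calc _ ≤ |t| * ε / 2 * (L₁ * ε ^ 3) := by gcongr
      _ = L₁ * (|t| * ε ^ 4) / 2 := by ring
      _ ≤ _ := by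
        have : 0 ≤ L₁ * (|t| * ε ^ 4) := by positivity
        linarith
  have e2 : |triple P Q R| ≤ L₂ * (ε ^ 6 + |t| * ε ^ 4) := by
    calc _ ≤ 6 * (((‖x‖ + p) * ε) * ((‖y‖ + q) * ε) * (K' * (ε ^ 4 + |t| * ε ^ 2))) :=
          (abs_triple_le _ _ _).trans (by gcongr)
      _ = _ := by rw [hL₂]; ring
  have e3 : 0 ≤ L₁ * ε ^ 6 := by positivity
  have e4 : 0 ≤ ε ^ 6 + |t| * ε ^ 4 := by positivity
  calc _ = |t * ε / 2 * (triple P Q xx - ε ^ 2 * triple x y xx) + triple P Q R| := by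
        congr 1; ring
    _ ≤ _ := (abs_add_le _ _).trans (by linarith)

/-- Taylor estimates for the edges and the mixed difference of a small coordinate quadrilateral. -/
lemma exists_edge_bounds {Ω : Set (ℝ × ℝ)} (hΩ : IsOpen Ω) {f : ℝ × ℝ → E3}
    (hf : ∀ p ∈ Ω, ContDiffAt ℝ (⊤ : ℕ∞) f p) {u v : ℝ} (h₀ : (u, v) ∈ Ω) :
    ∃ K ≥ 0, ∃ r > 0, (∀ s t : ℝ, |s| < r → |t| < r → (u + s, v + t) ∈ Ω) ∧
      ∀ ε : ℝ, 0 < ε → 2 * ε < r →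
      ‖f (u + ε, v) - f (u, v) -
        (ε • pd1 f (u, v) + (ε ^ 2 / 2) • pd1 (pd1 f) (u, v))‖ ≤ K * ε ^ 3 ∧
      ‖f (u, v + ε) - f (u, v) -
        (ε • pd2 f (u, v) + (ε ^ 2 / 2) • pd2 (pd2 f) (u, v))‖ ≤ K * ε ^ 3 ∧
      ‖(f (u + ε, v + ε) - f (u + ε, v)) - (f (u, v + ε) - f (u, v)) -
        (ε ^ 2 • pd2 (pd1 f) (u, v) + (ε ^ 3 / 2) •
          (pd1 (pd2 (pd1 f)) (u, v) + pd2 (pd2 (pd1 f)) (u, v)))‖ ≤ K * ε ^ 4 ∧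
      ∀ t : ℝ, |t| ≤ ε →
        ‖f (u + ε + t, v + ε) - f (u + ε, v + ε) -
          (t • (pd1 f (u, v) + ε • pd1 (pd1 f) (u, v) + ε • pd2 (pd1 f) (u, v)) +
            (t ^ 2 / 2) • pd1 (pd1 f) (u, v))‖ ≤ K * ε ^ 2 * |t| := by
  have hf₁ : ∀ p ∈ Ω, ContDiffAt ℝ (⊤ : ℕ∞) (pd1 f) p := fun p hp => contDiffAt_pd1 (hf p hp)
  have hd : ∀ p ∈ Ω, DifferentiableAt ℝ f p := fun p hp => (hf p hp).differentiableAt (by simp)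
  have hd₁ : ∀ p ∈ Ω, DifferentiableAt ℝ (pd1 f) p :=
    fun p hp => (hf₁ p hp).differentiableAt (by simp)
  obtain ⟨K₁, hK₁, r₁, hr₁, H₁⟩ := exists_norm_sub_taylor_le (hf₁ _ h₀)
  obtain ⟨K₂, hK₂, r₂, hr₂, H₂⟩ := exists_norm_sub_taylor_le (contDiffAt_pd2 (hf _ h₀))
  obtain ⟨K₃, hK₃, r₃, hr₃, H₃⟩ := exists_norm_sub_taylor_le (contDiffAt_pd2 (hf₁ _ h₀))
  obtain ⟨r₄, hr₄, hball⟩ := Metric.isOpen_iff.1 hΩ _ h₀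
  have hmem : ∀ s t : ℝ, |s| < r₄ → |t| < r₄ → (u + s, v + t) ∈ Ω := by
    intro s t hs ht
    exact hball (by simp [mem_ball, Prod.dist_eq, hs, ht])
  refine ⟨4 * K₁ + K₂ + K₃, by positivity, min (min r₁ r₂) (min r₃ r₄),
    lt_min (lt_min hr₁ hr₂) (lt_min hr₃ hr₄), fun s t hs ht => hmem s t
      (hs.trans_le ((min_le_right _ _).trans (min_le_right _ _)))
      (ht.trans_le ((min_le_right _ _).trans (min_le_right _ _))), fun ε hε hεr => ?_⟩
  simp only [lt_min_iff] at hεr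
  obtain ⟨⟨hε₁, hε₂⟩, hε₃, hε₄⟩ := hεr
  have habs : ∀ s ∈ Set.uIcc 0 ε, |s| ≤ ε := by
    intro s hs
    rw [Set.uIcc_of_le hε.le] at hs
    exact abs_le.2 ⟨by linarith [hs.1], hs.2⟩
  have hεabs : |ε| = ε := abs_of_pos hε
  refine ⟨?_, ?_, ?_, ?_⟩
  · have := norm_sub_quadratic_le (γ := fun s => f (u + s, v)) (γ' := fun s => pd1 f (u + s, v))
      (x := pd1 f (u, v)) (w := pd1 (pd1 f) (u, v)) (C := K₁ * ε ^ 2) (τ := ε)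
      (fun s hs => hasDerivAt_comp_add_fst (hd _ (by
        simpa using hmem s 0 (by linarith [habs s hs]) (by simpa using hr₄))))
      (fun s hs => by
        have := H₁ s 0 ε (habs s hs) (by simpa using hε.le) (by linarith)
        rw [zero_smul, add_zero, add_zero] at this
        rwa [← sub_sub])
    rw [add_zero, hεabs] at this
    refine this.trans ?_
    rw [mul_assoc, ← pow_succ]
    gcongr
    linarith
  · have := norm_sub_quadratic_le (γ := fun s => f (u, v + s)) (γ' := fun s => pd2 f (u, v + s))
      (x := pd2 f (u, v)) (w := pd2 (pd2 f) (u, v)) (C := K₂ * ε ^ 2) (τ := ε)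
      (fun s hs => hasDerivAt_comp_add_snd (hd _ (by
        simpa using hmem 0 s (by simpa using hr₄) (by linarith [habs s hs]))))
      (fun s hs => by
        have := H₂ 0 s ε (by simpa using hε.le) (habs s hs) (by linarith)
        rw [zero_smul, zero_add, add_zero] at this
        rwa [← sub_sub])
    rw [add_zero, hεabs] at this
    refine this.trans ?_
    rw [mul_assoc, ← pow_succ]
    gcongr
    linarith
  · set m := pd2 (pd1 f) (u, v)
    set p := pd1 (pd2 (pd1 f)) (u, v)
    set q := pd2 (pd2 (pd1 f)) (u, v)
    have inner : ∀ s ∈ Set.uIcc 0 ε, ‖pd1 f (u + s, v + ε) - pd1 f (u + s, v) -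
        (ε • (m + s • p) + (ε ^ 2 / 2) • q)‖ ≤ K₃ * ε ^ 2 * |ε| := by
      intro s hs
      have := norm_sub_quadratic_le (γ := fun t => pd1 f (u + s, v + t))
        (γ' := fun t => pd2 (pd1 f) (u + s, v + t)) (x := m + s • p) (w := q)
        (C := K₃ * ε ^ 2) (τ := ε)
        (fun t ht => hasDerivAt_comp_add_snd (hd₁ _
          (hmem s t (by linarith [habs s hs]) (by linarith [habs t ht]))))
        (fun t ht => by
          have := H₃ s t ε (habs s hs) (habs t ht) (by linarith)
          rwa [add_assoc, ← sub_sub])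
      rwa [add_zero] at this
    have := norm_sub_quadratic_le (γ := fun s => f (u + s, v + ε) - f (u + s, v))
      (γ' := fun s => pd1 f (u + s, v + ε) - pd1 f (u + s, v))
      (x := ε • m + (ε ^ 2 / 2) • q) (w := ε • p) (C := K₃ * ε ^ 2 * |ε|) (τ := ε)
      (fun s hs => (hasDerivAt_comp_add_fst (hd _ (hmem s ε (by linarith [habs s hs])
          (by linarith)))).sub (hasDerivAt_comp_add_fst (hd _ (by
          simpa using hmem s 0 (by linarith [habs s hs]) (by simpa using hr₄)))))
      (fun s hs => by
        refine (congrArg norm ?_).trans_le (inner s hs)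
        module)
    rw [add_zero, hεabs] at this
    have he : ε ^ 2 • m + (ε ^ 3 / 2) • (p + q) =
        ε • (ε • m + (ε ^ 2 / 2) • q) + (ε ^ 2 / 2) • ε • p := by module
    rw [he]
    refine this.trans ?_
    calc _ = K₃ * ε ^ 4 := by ring
      _ ≤ _ := by gcongr; linarith
  · intro t ht
    set x := pd1 f (u, v)
    set w := pd1 (pd1 f) (u, v)
    set m := pd2 (pd1 f) (u, v)
    have habs' : ∀ s ∈ Set.uIcc 0 t, |ε + s| ≤ 2 * ε := by
      intro s hs
      have h1 : |s| ≤ |t| := by simpa using Set.abs_sub_left_of_mem_uIcc hs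
      have := abs_add_le ε s
      linarith
    have := norm_sub_quadratic_le (γ := fun s => f (u + ε + s, v + ε))
      (γ' := fun s => pd1 f (u + ε + s, v + ε))
      (x := x + ε • w + ε • m) (w := w) (C := K₁ * (2 * ε) ^ 2) (τ := t)
      (fun s hs => hasDerivAt_comp_add_fst (hd _ (by
        rw [add_assoc]
        exact hmem _ _ (by linarith [habs' s hs]) (by linarith))))
      (fun s hs => by
        have := H₁ (ε + s) ε (2 * ε) (habs' s hs) (by linarith) hε₁
        rw [← add_assoc] at this
        refine (congrArg norm ?_).trans_le this
        module)
    rw [add_zero] at this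
    refine this.trans ?_
    calc _ = (4 * K₁) * ε ^ 2 * |t| := by ring
      _ ≤ _ := by gcongr; linarith

lemma fderiv_smul_add_smul_apply {a b : ℝ × ℝ → ℝ} {g h : ℝ × ℝ → E3} {p : ℝ × ℝ}
    (ha : DifferentiableAt ℝ a p) (hb : DifferentiableAt ℝ b p)
    (hg : DifferentiableAt ℝ g p) (hh : DifferentiableAt ℝ h p) (w : ℝ × ℝ) :
    fderiv ℝ (fun q => a q • g q + b q • h q) p w =
      a p • fderiv ℝ g p w + fderiv ℝ a p w • g p +
        (b p • fderiv ℝ h p w + fderiv ℝ b p w • h p) := by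
  rw [((ha.hasFDerivAt.fun_smul hg.hasFDerivAt).fun_add
    (hb.hasFDerivAt.fun_smul hh.hasFDerivAt)).fderiv]
  simp

/-- On a conjugate net, the third mixed derivatives are tangential up to `a f_uu + b f_vv`. -/
lemma exists_pd_mixed_eq {Ω : Set (ℝ × ℝ)} (hΩ : IsOpen Ω) {f : ℝ × ℝ → E3}
    (hf : ∀ p ∈ Ω, ContDiffAt ℝ (⊤ : ℕ∞) f p) {a b : ℝ × ℝ → ℝ} {p : ℝ × ℝ} (hp : p ∈ Ω)
    (ha : DifferentiableAt ℝ a p) (hb : DifferentiableAt ℝ b p)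
    (hconj : ∀ p ∈ Ω, pd2 (pd1 f) p = a p • pd1 f p + b p • pd2 f p) :
    ∃ α β : ℝ, pd1 (pd2 (pd1 f)) p + pd2 (pd2 (pd1 f)) p =
      a p • pd1 (pd1 f) p + b p • pd2 (pd2 f) p + α • pd1 f p + β • pd2 f p := by
  have hev : pd2 (pd1 f) =ᶠ[nhds p] fun q => a q • pd1 f q + b q • pd2 f q :=
    Filter.eventually_of_mem (hΩ.mem_nhds hp) hconj
  have h1 := (contDiffAt_pd1 (hf p hp)).differentiableAt (by simp)
  have h2 := (contDiffAt_pd2 (hf p hp)).differentiableAt (by simp)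
  refine ⟨fderiv ℝ a p (1, 0) + fderiv ℝ a p (0, 1) + a p * b p + a p ^ 2,
    fderiv ℝ b p (1, 0) + fderiv ℝ b p (0, 1) + a p * b p + b p ^ 2, ?_⟩
  have e1 : fderiv ℝ (pd2 f) p (1, 0) = a p • pd1 f p + b p • pd2 f p :=
    (pd1_pd2_comm (hf p hp)).trans (hconj p hp)
  have e2 : fderiv ℝ (pd1 f) p (0, 1) = a p • pd1 f p + b p • pd2 f p := hconj p hp
  change fderiv ℝ (pd2 (pd1 f)) p (1, 0) + fderiv ℝ (pd2 (pd1 f)) p (0, 1) =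
    a p • fderiv ℝ (pd1 f) p (1, 0) + b p • fderiv ℝ (pd2 f) p (0, 1) + _ + _
  rw [hev.fderiv_eq, fderiv_smul_add_smul_apply ha hb h1 h2,
    fderiv_smul_add_smul_apply ha hb h1 h2, e1, e2]
  module

/-- The conclusion when `f_uu` is not tangential: move `D` along the `u`-parameter line. -/
lemma exists_point_of_triple_ne_zero {Ω : Set (ℝ × ℝ)} (hΩ : IsOpen Ω) {f : ℝ × ℝ → E3}
    (hf : ∀ p ∈ Ω, ContDiffAt ℝ (⊤ : ℕ∞) f p) {a b : ℝ × ℝ → ℝ} {u v : ℝ} (h₀ : (u, v) ∈ Ω)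
    (ha : DifferentiableAt ℝ a (u, v)) (hb : DifferentiableAt ℝ b (u, v))
    (hconj : ∀ p ∈ Ω, pd2 (pd1 f) p = a p • pd1 f p + b p • pd2 f p)
    (hτ : triple (pd1 f (u, v)) (pd2 f (u, v)) (pd1 (pd1 f) (u, v)) ≠ 0) :
    ∃ C₀ > (0 : ℝ), ∃ ε₀ > (0 : ℝ), ∀ ε : ℝ, 0 < ε → ε < ε₀ →
      ∃ M : E3, M ∈ affineSpan ℝ ({f (u, v), f (u + ε, v), f (u, v + ε)} : Set E3) ∧
        M ∈ f '' Ω ∧ ‖M - f (u + ε, v + ε)‖ ≤ C₀ * ε ^ 3 := by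
  obtain ⟨α, β, hαβ⟩ := exists_pd_mixed_eq hΩ hf h₀ ha hb hconj
  obtain ⟨K, hK, r, hr, hmem, hedge⟩ := exists_edge_bounds hΩ hf h₀
  rw [hαβ, hconj _ h₀] at hedge
  set x := pd1 f (u, v)
  set y := pd2 f (u, v)
  set xx := pd1 (pd1 f) (u, v)
  set yy := pd2 (pd2 f) (u, v)
  set m := a (u, v) • x + b (u, v) • y
  set τ := triple x y xx
  obtain ⟨K', hK', hcomb⟩ :=
    exists_combination_bound x y xx yy (a (u, v)) (b (u, v)) α β K hK
  obtain ⟨L, hL, htri⟩ := exists_triple_bound x y xx yy K K' hK hK'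
  have hτ0 : 0 < |τ| := abs_pos.2 hτ
  set S := (4 * L + 1) / |τ| with hS
  have hS0 : 0 < S := by positivity
  have hSτ : S * |τ| = 4 * L + 1 := div_mul_cancel₀ _ hτ0.ne'
  refine ⟨S * (‖x‖ + 2 * ‖xx‖ + ‖m‖ + K + 1), by positivity,
    min (min 1 (r / 2)) (min (1 / S) (|τ| / L)), by positivity, fun ε hε hεlt => ?_⟩
  simp only [lt_min_iff] at hεlt
  obtain ⟨⟨hε1, hεr⟩, hεS, hεL⟩ := hεlt
  rw [lt_div_iff₀ hS0] at hεS
  rw [lt_div_iff₀ hL] at hεL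
  have hε2 : ε ^ 2 ≤ ε := by nlinarith
  have hSε2 : S * ε ^ 3 ≤ ε ^ 2 := by
    calc S * ε ^ 3 = (ε * S) * ε ^ 2 := by ring
      _ ≤ 1 * ε ^ 2 := by gcongr
      _ = ε ^ 2 := one_mul _
  obtain ⟨hP, hQ, hδ, hE⟩ := hedge ε hε (by linarith)
  set A := f (u, v)
  set B := f (u + ε, v)
  set C := f (u, v + ε)
  set D := f (u + ε, v + ε)
  obtain ⟨hw, htri⟩ := htri ε hε hε1.le _ _ hP hQ
  have hne : triple (B - A) (C - A) xx ≠ 0 := by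
    intro h
    rw [h, zero_sub, abs_neg, abs_mul, abs_of_pos (by positivity : 0 < ε ^ 2)] at hw
    have : ε ^ 2 * (ε * L) < ε ^ 2 * |τ| := by gcongr
    linarith
  set φ : ℝ → ℝ := fun t => triple (B - A) (C - A) (f (u + ε + t, v + ε) - A)
  have hest : ∀ t, |t| ≤ S * ε ^ 3 →
      |φ t - t * ε ^ 3 / 2 * τ| ≤ 2 * L * ε ^ 6 := by
    intro t ht
    obtain ⟨c, d, R, hsum, hR⟩ := hcomb ε t hε hε1.le (ht.trans hSε2) _ _ _ _ hP hQ hδ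
      (hE t ((ht.trans hSε2).trans hε2))
    have hsum' : f (u + ε + t, v + ε) - A =
        c • (B - A) + d • (C - A) + (t * ε / 2) • xx + R := by
      rw [← hsum]; abel
    have := htri c d t R hR
    rw [← hsum'] at this
    refine this.trans ?_
    have h6 : |t| * ε ^ 4 ≤ ε ^ 6 := by
      calc |t| * ε ^ 4 ≤ ε ^ 2 * ε ^ 4 := by gcongr; exact ht.trans hSε2
        _ = ε ^ 6 := by ring
    calc L * (ε ^ 6 + |t| * ε ^ 4) ≤ L * (ε ^ 6 + ε ^ 6) := by gcongr
      _ = _ := by ring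
  have hSε : 0 ≤ S * ε ^ 3 := by positivity
  have hτsq : τ * τ = |τ| * |τ| := (abs_mul_abs_self τ).symm
  have hend : ∀ t, |t| ≤ S * ε ^ 3 →
      |τ * φ t - t * ε ^ 3 / 2 * (|τ| * |τ|)| ≤ |τ| * (2 * L * ε ^ 6) := by
    intro t ht
    rw [← hτsq]
    calc _ = |τ| * |φ t - t * ε ^ 3 / 2 * τ| := by rw [← abs_mul]; congr 1; ring
      _ ≤ _ := by gcongr; exact hest t ht
  have hcal : S * ε ^ 3 * ε ^ 3 / 2 * (|τ| * |τ|) = |τ| * ((4 * L + 1) / 2 * ε ^ 6) := by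
    rw [← hSτ]; ring
  have hε6 : 0 ≤ |τ| * ε ^ 6 := by positivity
  have hpos : 0 ≤ τ * φ (S * ε ^ 3) := by
    have := (abs_le.1 (hend (S * ε ^ 3) (abs_of_nonneg hSε).le)).1
    rw [hcal] at this
    linarith
  have hneg : τ * φ (-(S * ε ^ 3)) ≤ 0 := by
    have := (abs_le.1 (hend (-(S * ε ^ 3)) (by rw [abs_neg, abs_of_nonneg hSε]))).2
    have h' : -(S * ε ^ 3) * ε ^ 3 / 2 * (|τ| * |τ|) = -(|τ| * ((4 * L + 1) / 2 * ε ^ 6)) := by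
      rw [← hcal]; ring
    rw [h'] at this
    linarith
  have hΩmem : ∀ t, |t| ≤ S * ε ^ 3 → (u + ε + t, v + ε) ∈ Ω := by
    intro t ht
    rw [add_assoc]
    have := abs_add_le ε t
    rw [abs_of_pos hε] at this
    exact hmem _ _ (by linarith) (by rw [abs_of_pos hε]; linarith)
  have hcont : ContinuousOn (fun t => τ * φ t) (Set.Icc (-(S * ε ^ 3)) (S * ε ^ 3)) := by
    intro t ht
    have h1 : ContinuousAt (fun t => f (u + ε + t, v + ε)) t :=
      (hasDerivAt_comp_add_fst
        ((hf _ (hΩmem t (abs_le.2 ht))).differentiableAt (by simp))).continuousAt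
    exact (continuousAt_const.mul ((continuous_triple _ _).continuousAt.comp
      (h1.sub continuousAt_const))).continuousWithinAt
  obtain ⟨t, ht, ht0⟩ := intermediate_value_Icc (by linarith) hcont ⟨hneg, hpos⟩
  have ht' : |t| ≤ S * ε ^ 3 := abs_le.2 ht
  refine ⟨f (u + ε + t, v + ε), mem_affineSpan_of_triple_eq_zero hne
    ((mul_eq_zero.1 ht0).resolve_left hτ), ⟨_, hΩmem t ht', rfl⟩, ?_⟩
  have htε : |t| ≤ ε := (ht'.trans hSε2).trans hε2
  have hE' := norm_le_norm_add_norm_sub' (f (u + ε + t, v + ε) - D)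
    (t • (x + ε • xx + ε • m) + (t ^ 2 / 2) • xx)
  have hn1 : ‖t • (x + ε • xx + ε • m)‖ ≤ |t| * (‖x‖ + ‖xx‖ + ‖m‖) := by
    rw [norm_smul, Real.norm_eq_abs]
    gcongr
    refine norm_add_le_of_le (norm_add_le_of_le le_rfl ?_) ?_ <;>
    · rw [norm_smul, Real.norm_eq_abs, abs_of_pos hε]
      exact mul_le_of_le_one_left (norm_nonneg _) hε1.le
  have hn2 : ‖(t ^ 2 / 2) • xx‖ ≤ |t| * ‖xx‖ := by
    rw [norm_smul, Real.norm_eq_abs, abs_div, abs_pow, abs_two]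
    gcongr
    nlinarith [abs_nonneg t]
  have hn3 : K * ε ^ 2 * |t| ≤ |t| * K := by
    calc K * ε ^ 2 * |t| ≤ K * 1 * |t| := by gcongr; linarith
      _ = |t| * K := by ring
  calc ‖f (u + ε + t, v + ε) - D‖
      ≤ |t| * (‖x‖ + ‖xx‖ + ‖m‖) + |t| * ‖xx‖ + |t| * K :=
        by linarith [norm_add_le_of_le hn1 hn2, hE t htε]
    _ ≤ |t| * (‖x‖ + 2 * ‖xx‖ + ‖m‖ + K + 1) := by linarith [abs_nonneg t]
    _ ≤ S * ε ^ 3 * (‖x‖ + 2 * ‖xx‖ + ‖m‖ + K + 1) := by gcongr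
    _ = _ := by ring

lemma pd1_comp_swap {f : ℝ × ℝ → E3} (p : ℝ × ℝ) :
    pd1 (f ∘ Prod.swap) p = pd2 f p.swap := by
  have := (ContinuousLinearEquiv.prodComm ℝ ℝ ℝ).comp_right_fderiv (f := f) (x := p)
  change fderiv ℝ (f ∘ (ContinuousLinearEquiv.prodComm ℝ ℝ ℝ)) p (1, 0) = _
  rw [this]
  rfl

lemma pd2_comp_swap {f : ℝ × ℝ → E3} (p : ℝ × ℝ) :
    pd2 (f ∘ Prod.swap) p = pd1 f p.swap := by
  have := (ContinuousLinearEquiv.prodComm ℝ ℝ ℝ).comp_right_fderiv (f := f) (x := p)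
  change fderiv ℝ (f ∘ (ContinuousLinearEquiv.prodComm ℝ ℝ ℝ)) p (0, 1) = _
  rw [this]
  rfl

lemma dot3_unitNormal (f : ℝ × ℝ → E3) (p : ℝ × ℝ) (z : E3) :
    dot3 z (unitNormal f p) =
      ‖cross3 (pd1 f p) (pd2 f p)‖⁻¹ * triple (pd1 f p) (pd2 f p) z := by
  simp only [triple, unitNormal, dot3, PiLp.smul_apply, smul_eq_mul]
  ring

/-- For a smooth non-degenerate conjugate net `f : Ω → ℝ³` and a point `(u₀, v₀) ∈ Ω` at
which the second fundamental form does not vanish, with `A = f(u₀,v₀)`, `B = f(u₀+ε,v₀)`,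
`C = f(u₀,v₀+ε)`, `D = f(u₀+ε,v₀+ε)`, one can choose a point `M` on the plane through
`A`, `B`, `C` and on the surface `f(Ω)` with `‖M − D‖ = O(ε³)`. -/
theorem exists_point_on_plane_and_surface_near_D
    (Ω : Set (ℝ × ℝ)) (hΩ : IsOpen Ω) (f : ℝ × ℝ → E3) (a b : ℝ × ℝ → ℝ)
    (hf : ContDiffOn ℝ (⊤ : ℕ∞) f Ω) (ha : ContDiffOn ℝ (⊤ : ℕ∞) a Ω) (hb : ContDiffOn ℝ (⊤ : ℕ∞) b Ω)
    (hindep : ∀ p ∈ Ω, LinearIndependent ℝ ![pd1 f p, pd2 f p])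
    (hconj : ∀ p ∈ Ω, pd2 (pd1 f) p = a p • pd1 f p + b p • pd2 f p)
    (u₀ v₀ : ℝ) (h₀ : (u₀, v₀) ∈ Ω)
    (hsff : ¬ (dot3 (pd1 (pd1 f) (u₀, v₀)) (unitNormal f (u₀, v₀)) = 0 ∧
               dot3 (pd2 (pd2 f) (u₀, v₀)) (unitNormal f (u₀, v₀)) = 0)) :
    ∃ C₀ > (0 : ℝ), ∃ ε₀ > (0 : ℝ), ∀ ε : ℝ, 0 < ε → ε < ε₀ →
      ∃ M : E3,
        M ∈ (affineSpan ℝ ({f (u₀, v₀), f (u₀ + ε, v₀), f (u₀, v₀ + ε)} : Set E3) : Set E3) ∧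
        M ∈ f '' Ω ∧
        ‖M - f (u₀ + ε, v₀ + ε)‖ ≤ C₀ * ε ^ 3 := by
  have hfA : ∀ p ∈ Ω, ContDiffAt ℝ (⊤ : ℕ∞) f p := fun p hp => hf.contDiffAt (hΩ.mem_nhds hp)
  have haA : DifferentiableAt ℝ a (u₀, v₀) :=
    (ha.contDiffAt (hΩ.mem_nhds h₀)).differentiableAt (by simp)
  have hbA : DifferentiableAt ℝ b (u₀, v₀) :=
    (hb.contDiffAt (hΩ.mem_nhds h₀)).differentiableAt (by simp)
  by_cases h1 : triple (pd1 f (u₀, v₀)) (pd2 f (u₀, v₀)) (pd1 (pd1 f) (u₀, v₀)) = 0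
  swap
  · exact exists_point_of_triple_ne_zero hΩ hfA h₀ haA hbA hconj h1
  have h2 : triple (pd1 f (u₀, v₀)) (pd2 f (u₀, v₀)) (pd2 (pd2 f) (u₀, v₀)) ≠ 0 := by
    intro h2
    exact hsff ⟨by rw [dot3_unitNormal, h1, mul_zero], by rw [dot3_unitNormal, h2, mul_zero]⟩
  have hpd1 : pd1 (f ∘ Prod.swap) = pd2 f ∘ Prod.swap := funext pd1_comp_swap
  have hpd2 : pd2 (f ∘ Prod.swap) = pd1 f ∘ Prod.swap := funext pd2_comp_swap
  obtain ⟨C₀, hC₀, ε₀, hε₀, H⟩ := exists_point_of_triple_ne_zero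
    (Ω := Prod.swap ⁻¹' Ω) (f := f ∘ Prod.swap) (a := b ∘ Prod.swap) (b := a ∘ Prod.swap)
    (u := v₀) (v := u₀) (hΩ.preimage continuous_swap)
    (fun p hp => (hfA _ hp).comp p (contDiff_snd.prodMk contDiff_fst).contDiffAt) h₀
    (DifferentiableAt.comp (v₀, u₀) hbA (differentiableAt_snd.prodMk differentiableAt_fst))
    (DifferentiableAt.comp (v₀, u₀) haA (differentiableAt_snd.prodMk differentiableAt_fst))
    (fun p hp => by
      rw [hpd1, hpd2, pd2_comp_swap, pd1_pd2_comm (hfA _ hp), hconj _ hp, add_comm]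
      rfl)
    (by
      rw [hpd1, hpd2, pd1_comp_swap]
      intro h
      apply h2
      rw [triple_eq] at h ⊢
      simp only [Function.comp_apply, Prod.swap_prod_mk] at h
      linarith)
  refine ⟨C₀, hC₀, ε₀, hε₀, fun ε hε hεlt => ?_⟩
  obtain ⟨M, hM, ⟨p, hp, hpM⟩, hMD⟩ := H ε hε hεlt
  refine ⟨M, ?_, ⟨p.swap, hp, hpM⟩, hMD⟩
  rw [Set.pair_comm]
  exact hM

end
end

section
/- Let f : Ω → ℝ³ be a smooth surface parametrized by curvature lines, let (u₀, v₀) ∈ Ω be a non-umbilic point, and for ε > 0 set A = f(u₀, v₀), B = f(u₀ + ε, v₀), C = f(u₀, v₀ + ε), D = f(u₀ + ε, v₀ + ε). Then the distance from D to the circle ω_ABC through A, B, C is O(ε³): there exist constants C₀ > 0 and ε₀ > 0 such that for all 0 < ε < ε₀ the points A, B, C are affinely independent and dist(D, ω_ABC) ≤ C₀ ε³. -/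
open Metric

noncomputable section

/-- The first principal curvature of a curvature-line parametrized surface. -/
def princCurv1 (f : ℝ × ℝ → E3) (p : ℝ × ℝ) : ℝ :=
  dot3 (pd1 (pd1 f) p) (unitNormal f p) / ‖pd1 f p‖ ^ 2

/-- The second principal curvature of a curvature-line parametrized surface. -/
def princCurv2 (f : ℝ × ℝ → E3) (p : ℝ × ℝ) : ℝ :=
  dot3 (pd2 (pd2 f) p) (unitNormal f p) / ‖pd2 f p‖ ^ 2

/-- The circle through three affinely independent points of `ℝ³`: the set of points of the
affine span of `{A, B, C}` whose distance to the circumcenter of the triangle `ABC` equals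
its circumradius. -/
def circleThrough (A B C : E3) (h : AffineIndependent ℝ ![A, B, C]) : Set E3 :=
  {x | x ∈ affineSpan ℝ ({A, B, C} : Set E3) ∧
       dist x (Affine.Simplex.circumcenter ⟨![A, B, C], h⟩) =
         Affine.Simplex.circumradius (⟨![A, B, C], h⟩ : Affine.Simplex ℝ E3 2)}

open scoped RealInnerProductSpace Topology
open Filter

section Circle

variable {A B C : E3}

/-- The power of the point `A + s (B - A) + t (C - A)` with respect to the circumcircle. -/
lemma dist_circumcenter_sq_sub_circumradius_sq (h : AffineIndependent ℝ ![A, B, C]) (s t : ℝ) :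
    dist (A + (s • (B - A) + t • (C - A)))
        (Affine.Simplex.circumcenter (⟨![A, B, C], h⟩ : Affine.Simplex ℝ E3 2)) ^ 2 -
      Affine.Simplex.circumradius (⟨![A, B, C], h⟩ : Affine.Simplex ℝ E3 2) ^ 2 =
    (s ^ 2 - s) * ‖B - A‖ ^ 2 + (t ^ 2 - t) * ‖C - A‖ ^ 2 + 2 * s * t * ⟪B - A, C - A⟫ := by
  set T : Affine.Simplex ℝ E3 2 := ⟨![A, B, C], h⟩
  have hA : dist A T.circumcenter = T.circumradius := T.dist_circumcenter_eq_circumradius 0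
  have hB : dist B T.circumcenter = T.circumradius := T.dist_circumcenter_eq_circumradius 1
  have hC : dist C T.circumcenter = T.circumradius := T.dist_circumcenter_eq_circumradius 2
  generalize T.circumcenter = O at *
  rw [dist_eq_norm] at *
  obtain ⟨a, rfl⟩ : ∃ a, A = O + a := ⟨A - O, by abel⟩
  obtain ⟨b, rfl⟩ : ∃ b, B = O + a + b := ⟨B - (O + a), by abel⟩
  obtain ⟨c, rfl⟩ : ∃ c, C = O + a + c := ⟨C - (O + a), by abel⟩
  have hA' : ⟪a, a⟫ = T.circumradius ^ 2 := by
    rw [real_inner_self_eq_norm_sq, ← hA]; congr 2; abel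
  have hB' : ⟪a + b, a + b⟫ = T.circumradius ^ 2 := by
    rw [real_inner_self_eq_norm_sq, ← hB]; congr 2; abel
  have hC' : ⟪a + c, a + c⟫ = T.circumradius ^ 2 := by
    rw [real_inner_self_eq_norm_sq, ← hC]; congr 2; abel
  have e1 : O + a + (s • (O + a + b - (O + a)) + t • (O + a + c - (O + a))) - O =
      a + (s • b + t • c) := by module
  rw [e1, add_sub_cancel_left, add_sub_cancel_left]
  simp only [← real_inner_self_eq_norm_sq, inner_add_left, inner_add_right, inner_smul_left,
    inner_smul_right, real_inner_comm a b, real_inner_comm a c, real_inner_comm b c,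
    conj_trivial] at *
  linear_combination (1 - s - t) * hA' + s * hB' + t * hC'

lemma half_dist_le_circumradius (h : AffineIndependent ℝ ![A, B, C]) :
    ‖B - A‖ / 2 ≤ Affine.Simplex.circumradius (⟨![A, B, C], h⟩ : Affine.Simplex ℝ E3 2) := by
  set T : Affine.Simplex ℝ E3 2 := ⟨![A, B, C], h⟩
  have hA : dist A T.circumcenter = T.circumradius := T.dist_circumcenter_eq_circumradius 0
  have hB : dist B T.circumcenter = T.circumradius := T.dist_circumcenter_eq_circumradius 1
  have := dist_triangle_right B A T.circumcenter
  rw [dist_eq_norm B A] at this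
  linarith

/-- A point of the plane `ABC` is at distance at most `|P| / r` from the circle through
`A`, `B`, `C`, where `P` is its power and `r` the circumradius. -/
lemma infDist_circleThrough_le_abs_power_div (h : AffineIndependent ℝ ![A, B, C]) {x : E3}
    (hx : x ∈ affineSpan ℝ ({A, B, C} : Set E3)) :
    infDist x (circleThrough A B C h) ≤
      |dist x (Affine.Simplex.circumcenter (⟨![A, B, C], h⟩ : Affine.Simplex ℝ E3 2)) ^ 2 -
        Affine.Simplex.circumradius (⟨![A, B, C], h⟩ : Affine.Simplex ℝ E3 2) ^ 2| /
      Affine.Simplex.circumradius (⟨![A, B, C], h⟩ : Affine.Simplex ℝ E3 2) := by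
  unfold circleThrough
  set T : Affine.Simplex ℝ E3 2 := ⟨![A, B, C], h⟩
  have hr : 0 < T.circumradius := T.circumradius_pos
  have hA : dist A T.circumcenter = T.circumradius := T.dist_circumcenter_eq_circumradius 0
  have hO : T.circumcenter ∈ affineSpan ℝ ({A, B, C} : Set E3) := by
    have := T.circumcenter_mem_affineSpan
    rwa [show Set.range T.points = {A, B, C} by
      ext y; simp [T]; tauto] at this
  rw [le_div_iff₀ hr]
  by_cases hxO : x = T.circumcenter
  · have hmem : A ∈ {y | y ∈ affineSpan ℝ ({A, B, C} : Set E3) ∧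
        dist y T.circumcenter = T.circumradius} :=
      ⟨subset_affineSpan ℝ _ (by simp), hA⟩
    have := infDist_le_dist_of_mem (x := x) hmem
    rw [dist_comm, hxO, hA] at this
    rw [hxO, dist_self, zero_pow two_ne_zero, zero_sub, abs_neg, abs_of_pos (by positivity)]
    nlinarith
  · have hd : 0 < dist x T.circumcenter := dist_pos.2 hxO
    set y := AffineMap.lineMap T.circumcenter x (T.circumradius / dist x T.circumcenter)
    have hy : dist y T.circumcenter = T.circumradius := by
      rw [dist_lineMap_left, Real.norm_of_nonneg (by positivity), dist_comm T.circumcenter x]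
      field_simp
    have hmem : y ∈ {y | y ∈ affineSpan ℝ ({A, B, C} : Set E3) ∧
        dist y T.circumcenter = T.circumradius} := ⟨AffineMap.lineMap_mem _ hO hx, hy⟩
    have hxy : dist x y = |dist x T.circumcenter - T.circumradius| := by
      rw [dist_comm, dist_lineMap_right, dist_comm T.circumcenter x, Real.norm_eq_abs]
      nth_rewrite 2 [← abs_of_pos hd]
      rw [← abs_mul]
      congr 1
      field_simp
    refine (mul_le_mul_of_nonneg_right (infDist_le_dist_of_mem hmem) hr.le).trans ?_
    rw [hxy, sq_sub_sq, abs_mul, mul_comm, abs_of_pos (add_pos hd hr)]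
    gcongr
    linarith

lemma infDist_circleThrough_le (h : AffineIndependent ℝ ![A, B, C]) (D : E3) (s t : ℝ) :
    infDist D (circleThrough A B C h) ≤ ‖D - (A + (s • (B - A) + t • (C - A)))‖ +
      2 * |(s ^ 2 - s) * ‖B - A‖ ^ 2 + (t ^ 2 - t) * ‖C - A‖ ^ 2 +
        2 * s * t * ⟪B - A, C - A⟫| / ‖B - A‖ := by
  have hBA : 0 < ‖B - A‖ := by
    rw [norm_pos_iff, sub_ne_zero]
    exact fun e => absurd (h.injective (a₁ := 1) (a₂ := 0) e) (by decide)
  have hx : A + (s • (B - A) + t • (C - A)) ∈ affineSpan ℝ ({A, B, C} : Set E3) := by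
    have hA : A ∈ affineSpan ℝ ({A, B, C} : Set E3) := subset_affineSpan ℝ _ (by simp)
    have hB : B ∈ affineSpan ℝ ({A, B, C} : Set E3) := subset_affineSpan ℝ _ (by simp)
    have hC : C ∈ affineSpan ℝ ({A, B, C} : Set E3) := subset_affineSpan ℝ _ (by simp)
    rw [add_comm]
    refine AffineSubspace.vadd_mem_of_mem_direction (add_mem ?_ ?_) hA
    · exact Submodule.smul_mem _ _ (AffineSubspace.vsub_mem_direction hB hA)
    · exact Submodule.smul_mem _ _ (AffineSubspace.vsub_mem_direction hC hA)
  have h1 := infDist_circleThrough_le_abs_power_div h hx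
  rw [dist_circumcenter_sq_sub_circumradius_sq] at h1
  rw [← dist_eq_norm D]
  refine (infDist_le_infDist_add_dist (y := A + (s • (B - A) + t • (C - A)))).trans ?_
  rw [add_comm]
  refine add_le_add_right (h1.trans ?_) _
  rw [mul_comm (2 : ℝ) |_|, mul_div_assoc, div_eq_mul_inv _ (Affine.Simplex.circumradius _)]
  refine mul_le_mul_of_nonneg_left ?_ (abs_nonneg _)
  rw [← inv_div]
  refine inv_anti₀ (by positivity) ?_
  exact half_dist_le_circumradius h

end Circle

section Taylor

variable {E F : Type*} [NormedAddCommGroup E] [NormedSpace ℝ E] [NormedAddCommGroup F]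
  [NormedSpace ℝ F]

/-- Second order Taylor expansion along a line, with cubic remainder. -/
lemma ContDiffAt.exists_taylor_two_along {f : E → F} {p : E} (hf : ContDiffAt ℝ 3 f p) (w : E) :
    ∃ K, ∀ᶠ ε : ℝ in 𝓝[>] 0, ∃ q : F, ‖q‖ ≤ K ∧
      f (p + ε • w) = f p + ε • fderiv ℝ f p w +
        (ε ^ 2 / 2) • fderiv ℝ (fun x => fderiv ℝ f x w) p w + ε ^ 3 • q := by
  set g : ℝ → F := fun t => f (p + t • w)
  have hline (t : ℝ) : HasDerivAt (fun t : ℝ => p + t • w) w t := by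
    simpa using ((hasDerivAt_id t).smul_const w).const_add p
  have hg : ContDiffAt ℝ 3 g 0 := by
    refine ContDiffAt.comp (0 : ℝ) (by simpa using hf) ?_
    fun_prop
  have hg1 : deriv g =ᶠ[𝓝 0] fun t => fderiv ℝ f (p + t • w) w := by
    have hev : ∀ᶠ x in 𝓝 p, ContDiffAt ℝ 3 f x := hf.eventually (by simp)
    have hcont : Tendsto (fun t : ℝ => p + t • w) (𝓝 0) (𝓝 p) := by
      simpa using (hline 0).continuousAt.tendsto
    filter_upwards [hcont.eventually hev] with t ht
    exact ((ht.differentiableAt (by simp)).hasFDerivAt.comp_hasDerivAt t (hline t)).deriv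
  have hg2 : deriv (deriv g) 0 = fderiv ℝ (fun x => fderiv ℝ f x w) p w := by
    rw [hg1.deriv_eq]
    have hd : DifferentiableAt ℝ (fun x => fderiv ℝ f x w) (p + (0 : ℝ) • w) := by
      rw [zero_smul, add_zero]
      exact ((hf.fderiv_right (m := 2) (by norm_num)).differentiableAt (by simp)).clm_apply
        (differentiableAt_const w)
    have := (hd.hasFDerivAt.comp_hasDerivAt (0 : ℝ) (hline 0)).deriv
    simpa [Function.comp_def] using this
  obtain ⟨δ, hδ, hball⟩ := Metric.eventually_nhds_iff.1 (hg.eventually (by simp))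
  have hon : ContDiffOn ℝ (2 + 1 : ℕ) g (Set.Icc 0 (δ / 2)) := fun t ht =>
    (hball (by rw [Real.dist_eq, sub_zero, abs_of_nonneg ht.1]; linarith [ht.2])).contDiffWithinAt
  obtain ⟨K, hK⟩ := exists_taylor_mean_remainder_bound (by positivity) hon
  have hu : UniqueDiffOn ℝ (Set.Icc 0 (δ / 2)) := uniqueDiffOn_Icc (by positivity)
  have h0 : (0 : ℝ) ∈ Set.Icc 0 (δ / 2) := ⟨le_rfl, by positivity⟩
  refine ⟨K, ?_⟩
  filter_upwards [Ioo_mem_nhdsGT (show (0 : ℝ) < δ / 2 by positivity)] with ε hε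
  have hε0 : 0 < ε := hε.1
  have hb := hK ε ⟨hε.1.le, hε.2.le⟩
  have hT : taylorWithinEval g 2 (Set.Icc 0 (δ / 2)) 0 ε = f p + ε • fderiv ℝ f p w +
        (ε ^ 2 / 2) • fderiv ℝ (fun x => fderiv ℝ f x w) p w := by
    rw [taylorWithinEval_succ, taylorWithinEval_succ, taylor_within_zero_eval,
      iteratedDerivWithin_eq_iteratedDeriv hu (hg.of_le (by norm_num)) h0,
      iteratedDerivWithin_eq_iteratedDeriv hu (hg.of_le (by norm_num)) h0,
      iteratedDeriv_succ, iteratedDeriv_zero, iteratedDeriv_succ, iteratedDeriv_one, hg2,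
      hg1.eq_of_nhds]
    simp [g]
    ring_nf
  rw [hT, sub_zero] at hb
  refine ⟨(ε ^ 3)⁻¹ • (g ε - (f p + ε • fderiv ℝ f p w +
        (ε ^ 2 / 2) • fderiv ℝ (fun x => fderiv ℝ f x w) p w)), ?_, ?_⟩
  · rw [norm_smul, Real.norm_of_nonneg (by positivity), inv_mul_le_iff₀ (by positivity), mul_comm]
    simpa using hb
  · rw [smul_inv_smul₀ (by positivity), add_sub_cancel]

end Taylor

lemma inner_eq_dot3 (x y : E3) : ⟪x, y⟫ = dot3 x y := by
  simp [dot3, PiLp.inner_apply, Fin.sum_univ_three, mul_comm]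

/-- The rescaled power of the point completing an infinitesimal curvature-line rectangle is
bounded. -/
lemma power_expansion {U V Uu Vv : E3} {α β : ℝ} (hUV : ⟪U, V⟫ = 0)
    (hu : ⟪Uu, V⟫ + ⟪U, α • U + β • V⟫ = 0) (hv : ⟪α • U + β • V, V⟫ + ⟪U, Vv⟫ = 0) (K : ℝ) :
    ∃ M, ∀ ε ∈ Set.Icc (0 : ℝ) 1, ∀ q r : E3, ‖q‖ ≤ K → ‖r‖ ≤ K →
      ∀ b c : E3, b = ε • U + (ε ^ 2 / 2) • Uu + ε ^ 3 • q →
        c = ε • V + (ε ^ 2 / 2) • Vv + ε ^ 3 • r →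
      |((1 + ε * α) ^ 2 - (1 + ε * α)) * ‖b‖ ^ 2 + ((1 + ε * β) ^ 2 - (1 + ε * β)) * ‖c‖ ^ 2 +
        2 * (1 + ε * α) * (1 + ε * β) * ⟪b, c⟫| ≤ M * ε ^ 4 := by
  let P (x : ℝ × E3 × E3) : E3 := (1 / 2 : ℝ) • Uu + x.1 • x.2.1
  let R (x : ℝ × E3 × E3) : E3 := (1 / 2 : ℝ) • Vv + x.1 • x.2.2
  let Q (x : ℝ × E3 × E3) : ℝ :=
    α ^ 2 * ⟪U, U⟫ + α * (1 + x.1 * α) * (2 * ⟪U, P x⟫ + x.1 * ⟪P x, P x⟫) +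
    β ^ 2 * ⟪V, V⟫ + β * (1 + x.1 * β) * (2 * ⟪V, R x⟫ + x.1 * ⟪R x, R x⟫) +
    2 * (⟪x.2.1, V⟫ + ⟪U, x.2.2⟫ + ⟪P x, R x⟫) * (1 + x.1 * (α + β) + x.1 ^ 2 * (α * β)) +
    (⟪Uu, V⟫ + ⟪U, Vv⟫) * (α + β + x.1 * (α * β))
  have hQ : Continuous Q := by fun_prop
  obtain ⟨M, hM⟩ := ((isCompact_Icc (a := (0 : ℝ)) (b := 1)).prod
    ((isCompact_closedBall (0 : E3) K).prod (isCompact_closedBall (0 : E3) K)))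
      |>.exists_bound_of_continuousOn hQ.continuousOn
  refine ⟨M, fun ε hε q r hq hr b c hb hc => ?_⟩
  have hMx := hM (ε, q, r) ⟨hε, by simpa using hq, by simpa using hr⟩
  rw [Real.norm_eq_abs] at hMx
  have hb' : b = ε • (U + ε • P (ε, q, r)) := by rw [hb]; simp only [P]; module
  have hc' : c = ε • (V + ε • R (ε, q, r)) := by rw [hc]; simp only [R]; module
  have hP : ⟪P (ε, q, r), V⟫ = ⟪Uu, V⟫ / 2 + ε * ⟪q, V⟫ := by
    simp only [P, inner_add_left, inner_smul_left, conj_trivial]; ring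
  have hR : ⟪U, R (ε, q, r)⟫ = ⟪U, Vv⟫ / 2 + ε * ⟪U, r⟫ := by
    simp only [R, inner_add_right, inner_smul_right]; ring
  have key : ((1 + ε * α) ^ 2 - (1 + ε * α)) * ‖b‖ ^ 2 +
      ((1 + ε * β) ^ 2 - (1 + ε * β)) * ‖c‖ ^ 2 +
        2 * (1 + ε * α) * (1 + ε * β) * ⟪b, c⟫ = Q (ε, q, r) * ε ^ 4 := by
    rw [hb', hc']
    simp only [Q]
    generalize P (ε, q, r) = p at *
    generalize R (ε, q, r) = s at *
    simp only [← real_inner_self_eq_norm_sq, inner_add_left, inner_add_right, inner_smul_left,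
      inner_smul_right, conj_trivial, real_inner_comm U p, real_inner_comm V s, hUV] at *
    rw [hP, hR]
    linear_combination ε ^ 3 * (hu + hv)
  rw [key, abs_mul, abs_of_nonneg (pow_nonneg hε.1 4)]
  exact mul_le_mul_of_nonneg_right hMx (pow_nonneg hε.1 4)

lemma ContDiffAt.differentiableAt_pd1 {f : ℝ × ℝ → E3} {p : ℝ × ℝ} (hf : ContDiffAt ℝ 3 f p) :
    DifferentiableAt ℝ (pd1 f) p :=
  ((hf.fderiv_right (m := 2) (by norm_num)).differentiableAt (by simp)).clm_apply
    (differentiableAt_const _)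

lemma ContDiffAt.differentiableAt_pd2 {f : ℝ × ℝ → E3} {p : ℝ × ℝ} (hf : ContDiffAt ℝ 3 f p) :
    DifferentiableAt ℝ (pd2 f) p :=
  ((hf.fderiv_right (m := 2) (by norm_num)).differentiableAt (by simp)).clm_apply
    (differentiableAt_const _)

/-- Mixed partial derivatives commute. -/
lemma pd1_pd2_eq_pd2_pd1 {f : ℝ × ℝ → E3} {p : ℝ × ℝ} (hf : ContDiffAt ℝ 3 f p) :
    pd1 (pd2 f) p = pd2 (pd1 f) p := by
  have hd : DifferentiableAt ℝ (fderiv ℝ f) p :=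
    (hf.fderiv_right (m := 2) (by norm_num)).differentiableAt (by simp)
  have key (v w : ℝ × ℝ) :
      fderiv ℝ (fun x => fderiv ℝ f x v) p w = fderiv ℝ (fderiv ℝ f) p w v := by
    rw [fderiv_clm_apply hd (differentiableAt_const v)]
    simp
  have hs := hf.isSymmSndFDerivAt (by simp; norm_num)
  exact (key _ _).trans ((hs _ _).trans (key _ _).symm)

/-- The second derivative along the diagonal in terms of partial derivatives. -/
lemma fderiv_fderiv_diagonal {f : ℝ × ℝ → E3} {p : ℝ × ℝ} (hf : ContDiffAt ℝ 3 f p) :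
    fderiv ℝ (fun x => fderiv ℝ f x (1, 1)) p (1, 1) =
      pd1 (pd1 f) p + (2 : ℝ) • pd2 (pd1 f) p +
        pd2 (pd2 f) p := by
  have h11 : ((1, 1) : ℝ × ℝ) = (1, 0) + (0, 1) := by simp
  have he : (fun x => fderiv ℝ f x (1, 1)) = pd1 f + pd2 f := by
    funext x
    rw [h11, map_add]
    rfl
  rw [he, fderiv_add hf.differentiableAt_pd1 hf.differentiableAt_pd2, h11, map_add]
  change pd1 (pd1 f) p + pd1 (pd2 f) p +
    (pd2 (pd1 f) p + pd2 (pd2 f) p) = _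
  rw [pd1_pd2_eq_pd2_pd1 hf]
  module

/-- Differentiating an orthogonality relation. -/
lemma inner_fderiv_add_inner_fderiv_eq_zero {g h : ℝ × ℝ → E3} {p : ℝ × ℝ}
    (hg : DifferentiableAt ℝ g p) (hh : DifferentiableAt ℝ h p)
    (horth : ∀ᶠ x in 𝓝 p, ⟪g x, h x⟫ = 0) (w : ℝ × ℝ) :
    ⟪fderiv ℝ g p w, h p⟫ + ⟪g p, fderiv ℝ h p w⟫ = 0 := by
  have h1 := fderiv_inner_apply ℝ hg hh w
  have h2 : (fun x => ⟪g x, h x⟫) =ᶠ[𝓝 p] fun _ => 0 := horth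
  rw [h2.fderiv_eq] at h1
  simp at h1
  linarith

/-- Three points `A`, `A + ε b`, `A + ε c` with `ε ≠ 0` and `b`, `c` linearly independent are
affinely independent. -/
lemma affineIndependent_add_smul {A b c : E3} {ε : ℝ} (hε : ε ≠ 0)
    (h : LinearIndependent ℝ ![b, c]) :
    AffineIndependent ℝ ![A, A + ε • b, A + ε • c] := by
  rw [affineIndependent_iff_linearIndependent_vsub ℝ _ (0 : Fin 3)]
  rw [← linearIndependent_equiv (finSuccAboveEquiv (0 : Fin 3))]
  have hsmul := h.units_smul (fun _ => Units.mk0 ε hε)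
  have e : (fun i : {i : Fin 3 // i ≠ 0} => ![A, A + ε • b, A + ε • c] i -ᵥ
      ![A, A + ε • b, A + ε • c] 0) ∘ finSuccAboveEquiv (0 : Fin 3) =
        (fun _ : Fin 2 => Units.mk0 ε hε) • ![b, c] := by
    funext i
    fin_cases i <;> simp [finSuccAboveEquiv_apply, Units.smul_def]
  exact e ▸ hsmul

/-- For a smooth surface parametrized by curvature lines and a non-umbilic point `(u₀,v₀)`,
with `A = f(u₀,v₀)`, `B = f(u₀+ε,v₀)`, `C = f(u₀,v₀+ε)`, `D = f(u₀+ε,v₀+ε)`, the distance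
from `D` to the circle through `A`, `B`, `C` is `O(ε³)`. -/
theorem dist_to_circle_of_curvature_line_net_isBigO_eps3
    (Ω : Set (ℝ × ℝ)) (hΩ : IsOpen Ω) (f : ℝ × ℝ → E3)
    (hf : ContDiffOn ℝ (⊤ : ℕ∞) f Ω)
    (hindep : ∀ p ∈ Ω, LinearIndependent ℝ ![pd1 f p, pd2 f p])
    (horth : ∀ p ∈ Ω, dot3 (pd1 f p) (pd2 f p) = 0)
    (hconj : ∀ p ∈ Ω, pd2 (pd1 f) p ∈ Submodule.span ℝ ({pd1 f p, pd2 f p} : Set E3))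
    (u₀ v₀ : ℝ) (h₀ : (u₀, v₀) ∈ Ω)
    (humb : princCurv1 f (u₀, v₀) ≠ princCurv2 f (u₀, v₀)) :
    ∃ C₀ > (0 : ℝ), ∃ ε₀ > (0 : ℝ), ∀ ε : ℝ, 0 < ε → ε < ε₀ →
      ∃ h : AffineIndependent ℝ ![f (u₀, v₀), f (u₀ + ε, v₀), f (u₀, v₀ + ε)],
        infDist (f (u₀ + ε, v₀ + ε))
          (circleThrough (f (u₀, v₀)) (f (u₀ + ε, v₀)) (f (u₀, v₀ + ε)) h)
          ≤ C₀ * ε ^ 3 := by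
  set p : ℝ × ℝ := (u₀, v₀)
  have hf3 : ContDiffAt ℝ 3 f p :=
    (hf.contDiffAt (hΩ.mem_nhds h₀)).of_le (WithTop.coe_le_coe.2 (le_top : (3 : ℕ∞) ≤ ⊤))
  have horth' : ∀ᶠ x in 𝓝 p, ⟪pd1 f x, pd2 f x⟫ = 0 := by
    filter_upwards [hΩ.mem_nhds h₀] with x hx
    rw [inner_eq_dot3, horth x hx]
  obtain ⟨α, β, hαβ⟩ := Submodule.mem_span_pair.1 (hconj p h₀)
  have hu := inner_fderiv_add_inner_fderiv_eq_zero hf3.differentiableAt_pd1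
    hf3.differentiableAt_pd2 horth' (1, 0)
  have hv := inner_fderiv_add_inner_fderiv_eq_zero hf3.differentiableAt_pd1
    hf3.differentiableAt_pd2 horth' (0, 1)
  change ⟪pd1 (pd1 f) p, pd2 f p⟫ + ⟪pd1 f p, pd1 (pd2 f) p⟫ = 0 at hu
  change ⟪pd2 (pd1 f) p, pd2 f p⟫ + ⟪pd1 f p, pd2 (pd2 f) p⟫ = 0 at hv
  rw [pd1_pd2_eq_pd2_pd1 hf3, ← hαβ] at hu
  rw [← hαβ] at hv
  obtain ⟨K₁, hB⟩ := hf3.exists_taylor_two_along (1, 0)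
  obtain ⟨K₂, hC⟩ := hf3.exists_taylor_two_along (0, 1)
  obtain ⟨K₃, hD⟩ := hf3.exists_taylor_two_along (1, 1)
  rw [fderiv_fderiv_diagonal hf3, ← hαβ,
    show ((1, 1) : ℝ × ℝ) = (1, 0) + (0, 1) by simp, map_add] at hD
  change ∀ᶠ ε : ℝ in 𝓝[>] 0, ∃ q : E3, ‖q‖ ≤ K₁ ∧ f (p + ε • (1, 0)) =
    f p + ε • pd1 f p + (ε ^ 2 / 2) • pd1 (pd1 f) p + ε ^ 3 • q at hB
  change ∀ᶠ ε : ℝ in 𝓝[>] 0, ∃ q : E3, ‖q‖ ≤ K₂ ∧ f (p + ε • (0, 1)) =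
    f p + ε • pd2 f p + (ε ^ 2 / 2) • pd2 (pd2 f) p + ε ^ 3 • q at hC
  change ∀ᶠ ε : ℝ in 𝓝[>] 0, ∃ q : E3, ‖q‖ ≤ K₃ ∧ f (p + ε • ((1, 0) + (0, 1))) =
    f p + ε • (pd1 f p + pd2 f p) + (ε ^ 2 / 2) • (pd1 (pd1 f) p +
      (2 : ℝ) • (α • pd1 f p + β • pd2 f p) + pd2 (pd2 f) p) + ε ^ 3 • q at hD
  have hUV := horth'.self_of_nhds
  have hli := hindep p h₀
  have hU : 0 < ‖pd1 f p‖ := norm_pos_iff.2 (hli.ne_zero 0)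
  generalize pd1 (pd1 f) p = Uu at *
  generalize pd2 (pd2 f) p = Vv at *
  generalize pd1 f p = U at *
  generalize pd2 f p = V at *
  obtain ⟨M, hM⟩ := power_expansion hUV hu hv (max K₁ K₂)
  have hslope {X Xx : E3} {K : ℝ} {w : ℝ × ℝ}
      (h : ∀ᶠ ε : ℝ in 𝓝[>] 0, ∃ q : E3, ‖q‖ ≤ K ∧ f (p + ε • w) =
        f p + ε • X + (ε ^ 2 / 2) • Xx + ε ^ 3 • q) :
      Tendsto (fun ε : ℝ => ε⁻¹ • (f (p + ε • w) - f p)) (𝓝[>] 0) (𝓝 X) := by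
    have hlim : Tendsto (fun ε : ℝ => ε / 2 * ‖Xx‖ + ε ^ 2 * K) (𝓝[>] 0) (𝓝 0) := by
      have : Continuous (fun ε : ℝ => ε / 2 * ‖Xx‖ + ε ^ 2 * K) := by fun_prop
      simpa using (this.tendsto 0).mono_left nhdsWithin_le_nhds
    rw [tendsto_iff_norm_sub_tendsto_zero]
    refine squeeze_zero' (Eventually.of_forall fun _ => norm_nonneg _) ?_ hlim
    filter_upwards [h, self_mem_nhdsWithin] with ε ⟨q, hq, he⟩ (hε : 0 < ε)
    have : ε⁻¹ • (f (p + ε • w) - f p) - X = (ε / 2) • Xx + ε ^ 2 • q := by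
      rw [he]
      match_scalars <;> field_simp <;> ring
    rw [this]
    refine (norm_add_le _ _).trans ?_
    rw [norm_smul, norm_smul, Real.norm_of_nonneg (by positivity),
      Real.norm_of_nonneg (by positivity)]
    gcongr
  have hb := hslope hB
  have hc := hslope hC
  have hind : ∀ᶠ ε : ℝ in 𝓝[>] 0, LinearIndependent ℝ
      ![ε⁻¹ • (f (p + ε • (1, 0)) - f p), ε⁻¹ • (f (p + ε • (0, 1)) - f p)] := by
    refine Tendsto.eventually (p := fun g : Fin 2 → E3 => LinearIndependent ℝ g) ?_
      (LinearIndependent.eventually hli)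
    rw [tendsto_pi_nhds]
    intro i
    fin_cases i
    · exact hb
    · exact hc
  have hnorm := hb.norm.eventually (lt_mem_nhds (half_lt_self hU))
  set L := K₃ + K₁ + K₂ + |α| * (‖Uu‖ / 2 + K₁) + |β| * (‖Vv‖ / 2 + K₂)
  have hmain : ∀ᶠ ε : ℝ in 𝓝[>] 0,
      ∃ h : AffineIndependent ℝ ![f (u₀, v₀), f (u₀ + ε, v₀), f (u₀, v₀ + ε)],
        infDist (f (u₀ + ε, v₀ + ε))
          (circleThrough (f (u₀, v₀)) (f (u₀ + ε, v₀)) (f (u₀, v₀ + ε)) h)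
          ≤ (|L| + 4 * |M| / ‖U‖ + 1) * ε ^ 3 := by
    filter_upwards [hB, hC, hD, hind, hnorm, Ioo_mem_nhdsGT (show (0 : ℝ) < 1 by norm_num)]
      with ε ⟨q, hq, heB⟩ ⟨r, hr, heC⟩ ⟨s, hs, heD⟩ hli' hn ⟨hε, hε1⟩
    have e1 : p + ε • ((1, 0) : ℝ × ℝ) = (u₀ + ε, v₀) := by simp [p]
    have e2 : p + ε • ((0, 1) : ℝ × ℝ) = (u₀, v₀ + ε) := by simp [p]
    have e3 : p + ε • (((1, 0) : ℝ × ℝ) + (0, 1)) = (u₀ + ε, v₀ + ε) := by simp [p]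
    rw [e1] at heB hli' hn
    rw [e2] at heC hli'
    rw [e3] at heD
    change ∃ h : AffineIndependent ℝ ![f p, f (u₀ + ε, v₀), f (u₀, v₀ + ε)],
      infDist _ (circleThrough (f p) _ _ h) ≤ _
    have hAI := affineIndependent_add_smul (A := f p) hε.ne' hli'
    rw [smul_inv_smul₀ hε.ne', smul_inv_smul₀ hε.ne', add_sub_cancel, add_sub_cancel] at hAI
    refine ⟨hAI, (infDist_circleThrough_le hAI _ (1 + ε * α) (1 + ε * β)).trans ?_⟩
    have hpow := hM ε ⟨hε.le, hε1.le⟩ q r (hq.trans (le_max_left _ _)) (hr.trans (le_max_right _ _))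
      (f (u₀ + ε, v₀) - f p) (f (u₀, v₀ + ε) - f p) (by rw [heB]; abel) (by rw [heC]; abel)
    have hnb : ε * (‖U‖ / 2) ≤ ‖f (u₀ + ε, v₀) - f p‖ := by
      rw [norm_smul, norm_inv, Real.norm_of_nonneg hε.le, lt_inv_mul_iff₀ hε] at hn
      exact hn.le
    have hfirst : ‖f (u₀ + ε, v₀ + ε) - (f p + ((1 + ε * α) • (f (u₀ + ε, v₀) - f p) +
        (1 + ε * β) • (f (u₀, v₀ + ε) - f p)))‖ ≤ |L| * ε ^ 3 := by
      have : f (u₀ + ε, v₀ + ε) - (f p + ((1 + ε * α) • (f (u₀ + ε, v₀) - f p) +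
          (1 + ε * β) • (f (u₀, v₀ + ε) - f p))) =
          ε ^ 3 • (s - q - r - α • ((1 / 2 : ℝ) • Uu + ε • q) -
            β • ((1 / 2 : ℝ) • Vv + ε • r)) := by
        rw [heB, heC, heD]
        module
      rw [this, norm_smul, Real.norm_of_nonneg (by positivity), mul_comm]
      refine mul_le_mul_of_nonneg_right (le_trans ?_ (le_abs_self L)) (by positivity)
      have hbd {X y : E3} {K : ℝ} (hy : ‖y‖ ≤ K) :
          ‖(1 / 2 : ℝ) • X + ε • y‖ ≤ ‖X‖ / 2 + K := by
        refine (norm_add_le _ _).trans ?_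
        rw [norm_smul, norm_smul, Real.norm_of_nonneg hε.le]
        have : ε * ‖y‖ ≤ ‖y‖ := mul_le_of_le_one_left (norm_nonneg _) hε1.le
        norm_num
        linarith
      refine (norm_sub_le _ _).trans (add_le_add ((norm_sub_le _ _).trans (add_le_add
        ((norm_sub_le _ _).trans (add_le_add ((norm_sub_le _ _).trans
          (add_le_add hs hq)) hr)) ?_)) ?_)
      · rw [norm_smul, Real.norm_eq_abs]
        exact mul_le_mul_of_nonneg_left (hbd hq) (abs_nonneg _)
      · rw [norm_smul, Real.norm_eq_abs]
        exact mul_le_mul_of_nonneg_left (hbd hr) (abs_nonneg _)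
    have hsecond : 2 * |((1 + ε * α) ^ 2 - (1 + ε * α)) * ‖f (u₀ + ε, v₀) - f p‖ ^ 2 +
        ((1 + ε * β) ^ 2 - (1 + ε * β)) * ‖f (u₀, v₀ + ε) - f p‖ ^ 2 +
        2 * (1 + ε * α) * (1 + ε * β) * ⟪f (u₀ + ε, v₀) - f p, f (u₀, v₀ + ε) - f p⟫| /
          ‖f (u₀ + ε, v₀) - f p‖ ≤ 4 * |M| / ‖U‖ * ε ^ 3 := by
      calc _ ≤ 2 * (|M| * ε ^ 4) / (ε * (‖U‖ / 2)) := by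
            gcongr
            exact hpow.trans (by gcongr; exact le_abs_self M)
        _ = _ := by field_simp; ring
    have : 0 < ε ^ 3 := by positivity
    linarith
  obtain ⟨ε₀, hε₀, hsub⟩ := mem_nhdsGT_iff_exists_Ioo_subset.1 hmain
  exact ⟨_, by positivity, ε₀, hε₀, fun ε h1 h2 => hsub ⟨h1, h2⟩⟩

end
end

section
/- Let f : Ω → ℝ³ be a smooth surface parametrized by curvature lines, let (u₀, v₀) ∈ Ω be a non-umbilic point, and for ε > 0 set A = f(u₀, v₀), B = f(u₀ + ε, v₀), C = f(u₀, v₀ + ε), D = f(u₀ + ε, v₀ + ε) and let ω_ABC be the circle through A, B, C. Then there exist constants C₀ > 0 and ε₀ > 0 such that for every 0 < ε < ε₀ there exists a point M lying both on the circle ω_ABC and in the image f(Ω) with ‖M − D‖ ≤ C₀ ε³. -/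
open Metric

noncomputable section

/-- The determinant of three vectors of `ℝ³`. -/
def det3 (x y z : E3) : ℝ :=
  z 0 * (x 1 * y 2 - x 2 * y 1) + z 1 * (x 2 * y 0 - x 0 * y 2) + z 2 * (x 0 * y 1 - x 1 * y 0)

/-- The Gram determinant of two vectors of `ℝ³`. -/
def gram (b c : E3) : ℝ := dot3 b b * dot3 c c - dot3 b c ^ 2

/-- Up to the factor `gram b c`, the diameter of the circle through `0`, `b`, `c` that starts
at `0`, as a vector. -/
def scaledDiameter (b c : E3) : E3 :=
  (dot3 b b * dot3 c c - dot3 b c * dot3 c c) • b + (dot3 b b * dot3 c c - dot3 b c * dot3 b b) • c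

/-- Up to the factor `gram b c`, the power of a point `m` with respect to the circle through
`0`, `b`, `c`. -/
def circlePower (b c m : E3) : ℝ := gram b c * dot3 m m - dot3 m (scaledDiameter b c)

lemma dot3_eq_inner (x y : E3) : dot3 x y = inner ℝ x y := by
  simp [dot3, PiLp.inner_apply, Fin.sum_univ_three]; ring

lemma dot3_self (x : E3) : dot3 x x = ‖x‖ ^ 2 := by
  rw [dot3_eq_inner, real_inner_self_eq_norm_sq]

lemma abs_dot3_le (x y : E3) : |dot3 x y| ≤ ‖x‖ * ‖y‖ := by
  rw [dot3_eq_inner]; exact abs_real_inner_le_norm x y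

lemma det3_eq_dot3_cross3 (x y z : E3) : det3 x y z = dot3 z (cross3 x y) := by
  simp [det3, dot3, cross3]

lemma gram_smul_eq (b c m : E3) (hdet : det3 b c m = 0) :
    gram b c • m = (dot3 m b * dot3 c c - dot3 m c * dot3 b c) • b +
      (dot3 m c * dot3 b b - dot3 m b * dot3 b c) • c := by
  have key : ∀ i, gram b c * m i - ((dot3 m b * dot3 c c - dot3 m c * dot3 b c) * b i +
      (dot3 m c * dot3 b b - dot3 m b * dot3 b c) * c i) = det3 b c m * (cross3 b c) i := by
    intro i
    fin_cases i <;> simp [gram, dot3, det3, cross3] <;> ring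
  ext i
  have := key i
  rw [hdet] at this
  simp only [PiLp.add_apply, PiLp.smul_apply, smul_eq_mul]
  linarith

lemma affineIndependent_of_gram_ne_zero {A B C : E3} (hG : gram (B - A) (C - A) ≠ 0) :
    AffineIndependent ℝ ![A, B, C] := by
  rw [affineIndependent_iff_not_collinear_set]
  intro hcol
  obtain ⟨v, hv⟩ := (collinear_iff_of_mem (p₀ := A) (by simp)).1 hcol
  obtain ⟨s, hs⟩ := hv B (by simp)
  obtain ⟨t, ht⟩ := hv C (by simp)
  apply hG
  rw [hs, ht]
  simp only [gram, dot3, vadd_eq_add, add_sub_cancel_right, PiLp.smul_apply, smul_eq_mul]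
  ring

lemma mem_circleThrough {A B C M : E3} (hG : gram (B - A) (C - A) ≠ 0)
    (hdet : det3 (B - A) (C - A) (M - A) = 0) (hpow : circlePower (B - A) (C - A) (M - A) = 0)
    (h : AffineIndependent ℝ ![A, B, C]) : M ∈ circleThrough A B C h := by
  obtain ⟨β, γ, hM, hβγ⟩ : ∃ β γ : ℝ, M - A = β • (B - A) + γ • (C - A) ∧
      dot3 (M - A) (M - A) = β * dot3 (B - A) (B - A) + γ * dot3 (C - A) (C - A) := by
    have key := gram_smul_eq _ _ _ hdet
    generalize B - A = b at *
    generalize C - A = c at *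
    generalize M - A = m at *
    refine ⟨(gram b c)⁻¹ * (dot3 m b * dot3 c c - dot3 m c * dot3 b c),
      (gram b c)⁻¹ * (dot3 m c * dot3 b b - dot3 m b * dot3 b c), ?_, ?_⟩
    · rw [mul_smul, mul_smul, ← smul_add, ← key, smul_smul, inv_mul_cancel₀ hG, one_smul]
    · have : gram b c * dot3 m m = (dot3 m b * dot3 c c - dot3 m c * dot3 b c) * dot3 b b +
          (dot3 m c * dot3 b b - dot3 m b * dot3 b c) * dot3 c c := by
        rw [circlePower, sub_eq_zero] at hpow
        rw [hpow]
        simp only [dot3, scaledDiameter, PiLp.add_apply, PiLp.smul_apply, smul_eq_mul]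
        ring
      field_simp
      linarith
  have hMA : M = β • (B - A) + γ • (C - A) + A := by rw [← hM]; abel
  refine ⟨?_, ?_⟩
  · have hA : A ∈ affineSpan ℝ ({A, B, C} : Set E3) := mem_affineSpan ℝ (by simp)
    have hB : B ∈ affineSpan ℝ ({A, B, C} : Set E3) := mem_affineSpan ℝ (by simp)
    have hC : C ∈ affineSpan ℝ ({A, B, C} : Set E3) := mem_affineSpan ℝ (by simp)
    rw [hMA]
    refine AffineSubspace.vadd_mem_of_mem_direction ?_ hA
    exact Submodule.add_mem _
      (Submodule.smul_mem _ _ (AffineSubspace.vsub_mem_direction hB hA))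
      (Submodule.smul_mem _ _ (AffineSubspace.vsub_mem_direction hC hA))
  · have h0 := Affine.Simplex.dist_circumcenter_eq_circumradius
      (⟨![A, B, C], h⟩ : Affine.Simplex ℝ E3 2) 0
    have h1 := Affine.Simplex.dist_circumcenter_eq_circumradius
      (⟨![A, B, C], h⟩ : Affine.Simplex ℝ E3 2) 1
    have h2 := Affine.Simplex.dist_circumcenter_eq_circumradius
      (⟨![A, B, C], h⟩ : Affine.Simplex ℝ E3 2) 2
    rw [← h0]
    rw [← h0] at h1 h2
    simp only [Matrix.cons_val_zero, Matrix.cons_val_one, Matrix.cons_val] at h0 h1 h2 ⊢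
    generalize Affine.Simplex.circumcenter (⟨![A, B, C], h⟩ : Affine.Simplex ℝ E3 2) = O at *
    rw [dist_eq_norm, dist_eq_norm] at h1 h2 ⊢
    have e1 : dot3 (B - O) (B - O) = dot3 (A - O) (A - O) := by rw [dot3_self, dot3_self, h1]
    have e2 : dot3 (C - O) (C - O) = dot3 (A - O) (A - O) := by rw [dot3_self, dot3_self, h2]
    have e3 : dot3 (M - O) (M - O) = dot3 (A - O) (A - O) := by
      have i1 : ∀ Z : E3, dot3 (Z - O) (Z - O) =
          dot3 (A - O) (A - O) + dot3 (Z - A) (Z - A) + 2 * dot3 (Z - A) (A - O) := by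
        intro Z; simp only [dot3, PiLp.sub_apply]; ring
      have i2 : dot3 (M - A) (A - O) = β * dot3 (B - A) (A - O) + γ * dot3 (C - A) (A - O) := by
        rw [hM]; simp only [dot3, PiLp.add_apply, PiLp.smul_apply, smul_eq_mul]; ring
      rw [i1] at e1 e2 ⊢
      rw [hβγ, i2]
      linear_combination β * e1 + γ * e2
    rw [dot3_self, dot3_self] at e3
    exact (sq_eq_sq₀ (norm_nonneg _) (norm_nonneg _)).1 e3

lemma exists_bound_of_continuous {V : Type*} [NormedAddCommGroup V] [ProperSpace V]
    {g : ℝ × V → ℝ} (hg : Continuous g) (K : ℝ) :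
    ∃ K', ∀ ε : ℝ, 0 ≤ ε → ε ≤ 1 → ∀ v : V, ‖v‖ ≤ K → |g (ε, v)| ≤ K' := by
  obtain ⟨K', hK'⟩ := (isCompact_Icc.prod (isCompact_closedBall (0 : V) K)).exists_bound_of_continuousOn
    (s := Set.Icc (0 : ℝ) 1 ×ˢ closedBall (0 : V) K) hg.continuousOn
  exact ⟨K', fun ε h0 h1 v hv => hK' (ε, v) ⟨⟨h0, h1⟩, by simpa using hv⟩⟩

lemma exists_lipschitz_bound {V F : Type*} [NormedAddCommGroup V] [NormedSpace ℝ V]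
    [ProperSpace V] [NormedAddCommGroup F] [NormedSpace ℝ F] {g : V → F}
    (hg : ContDiff ℝ 1 g) (z₀ : V) (K : ℝ) :
    ∃ K', ∀ z : V, ‖z - z₀‖ ≤ K → ‖g z - g z₀‖ ≤ K' * ‖z - z₀‖ := by
  obtain ⟨K', hK'⟩ := (isCompact_closedBall z₀ K).exists_bound_of_continuousOn
    (hg.continuous_fderiv (by simp)).continuousOn
  refine ⟨K', fun z hz => ?_⟩
  have hK : 0 ≤ K := (norm_nonneg _).trans hz
  exact (convex_closedBall z₀ K).norm_image_sub_le_of_norm_fderiv_le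
    (fun x _ => hg.differentiable (by simp) x) (fun x hx => hK' x hx)
    (mem_closedBall_self hK) (by simpa [dist_eq_norm] using hz)

/-- If `b` and `c` are the scaled edges issuing from a vertex of a small curvature line
quadrilateral, then its scaled diagonal is nearly coplanar to them. -/
lemma det3_diagonal_bound (X Y P Q w r : E3) (h1 : det3 X Y w = 0)
    (h2 : det3 P Y w + det3 X Q w + 2 * det3 X Y r = 0) (K : ℝ) :
    ∃ K', ∀ ε : ℝ, 0 ≤ ε → ε ≤ 1 → ∀ b₂ c₂ e₃ : E3, ‖b₂‖ ≤ K → ‖c₂‖ ≤ K → ‖e₃‖ ≤ K →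
      ∀ b c m : E3, b = X + ε • ((1 / 2 : ℝ) • P + ε • b₂) →
        c = Y + ε • ((1 / 2 : ℝ) • Q + ε • c₂) → m = b + c + ε • (w + ε • (r + ε • e₃)) →
        |det3 b c m| ≤ K' * ε ^ 3 := by
  let g : ℝ × (E3 × E3 × E3) → ℝ := fun z =>
    let b' := (1 / 2 : ℝ) • P + z.1 • z.2.1
    let c' := (1 / 2 : ℝ) • Q + z.1 • z.2.2.1
    let e' := r + z.1 • z.2.2.2
    (det3 z.2.1 Y w + det3 X z.2.2.1 w + det3 X Y z.2.2.2) +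
      (det3 b' c' w + det3 b' Y e' + det3 X c' e') + z.1 * det3 b' c' e'
  have hg : Continuous g := by
    simp only [g, det3, PiLp.add_apply, PiLp.smul_apply, smul_eq_mul]
    fun_prop
  obtain ⟨K', hK'⟩ := exists_bound_of_continuous hg K
  refine ⟨K', fun ε h0 h1' b₂ c₂ e₃ hb hc he b c m hbe hce hme => ?_⟩
  have hgv := hK' ε h0 h1' (b₂, c₂, e₃) (by simp [Prod.norm_def, hb, hc, he])
  have : det3 b c m = g (ε, b₂, c₂, e₃) * ε ^ 3 := by
    subst hbe hce hme
    simp only [g, det3, PiLp.add_apply, PiLp.smul_apply, smul_eq_mul] at h1 h2 ⊢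
    linear_combination ε * h1 + ε ^ 2 / 2 * h2
  rw [this, abs_mul, abs_of_nonneg (by positivity : 0 ≤ ε ^ 3)]
  gcongr

lemma det3_tangent_bound (X Y P Q w : E3) (h1 : det3 X Y w = 0) (K : ℝ) :
    ∃ K', ∀ ε : ℝ, 0 ≤ ε → ε ≤ 1 → ∀ b₂ c₂ k : E3, ‖b₂‖ ≤ K → ‖c₂‖ ≤ K → ‖k‖ ≤ K →
      ∀ b c U : E3, b = X + ε • ((1 / 2 : ℝ) • P + ε • b₂) →
        c = Y + ε • ((1 / 2 : ℝ) • Q + ε • c₂) → U = X + ε • (P + w + ε • k) →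
        |det3 b c U - ε * (det3 X Y P / 2)| ≤ K' * ε ^ 2 := by
  let g : ℝ × (E3 × E3 × E3) → ℝ := fun z =>
    let b' := (1 / 2 : ℝ) • P + z.1 • z.2.1
    let c' := (1 / 2 : ℝ) • Q + z.1 • z.2.2.1
    let U' := P + w + z.1 • z.2.2.2
    det3 z.2.1 Y X + det3 X Y z.2.2.2 +
      (det3 b' c' X + det3 b' Y U' + det3 X c' U') + z.1 * det3 b' c' U'
  have hg : Continuous g := by
    simp only [g, det3, PiLp.add_apply, PiLp.smul_apply, smul_eq_mul]
    fun_prop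
  obtain ⟨K', hK'⟩ := exists_bound_of_continuous hg K
  refine ⟨K', fun ε h0 h1' b₂ c₂ e₃ hb hc he b c m hbe hce hme => ?_⟩
  have hgv := hK' ε h0 h1' (b₂, c₂, e₃) (by simp [Prod.norm_def, hb, hc, he])
  have : det3 b c m - ε * (det3 X Y P / 2) = g (ε, b₂, c₂, e₃) * ε ^ 2 := by
    subst hbe hce hme
    simp only [g, det3, PiLp.add_apply, PiLp.smul_apply, smul_eq_mul] at h1 ⊢
    linear_combination ε * h1
  rw [this, abs_mul, abs_of_nonneg (by positivity : 0 ≤ ε ^ 2)]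
  gcongr

lemma circlePower_add (b c e : E3) :
    circlePower b c (b + c + e) = dot3 b b * dot3 c c * (2 * dot3 b c + dot3 (b + c) e) +
      (-2 * dot3 b c ^ 3 - 2 * dot3 b c ^ 2 * dot3 (b + c) e + gram b c * dot3 e e +
        dot3 b c * (dot3 b b * dot3 c e + dot3 c c * dot3 b e)) := by
  have e1 : ∀ x y z : E3, dot3 (x + y) z = dot3 x z + dot3 y z := by
    intro x y z; simp only [dot3, PiLp.add_apply]; ring
  have e2 : ∀ x y z : E3, dot3 z (x + y) = dot3 z x + dot3 z y := by
    intro x y z; simp only [dot3, PiLp.add_apply]; ring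
  have e3 : ∀ (t : ℝ) (y z : E3), dot3 z (t • y) = t * dot3 z y := by
    intro x y z; simp only [dot3, PiLp.smul_apply, smul_eq_mul]; ring
  have e4 : ∀ y z : E3, dot3 z y = dot3 y z := by
    intro y z; simp only [dot3]; ring
  simp only [circlePower, gram, scaledDiameter, e1, e2, e3]
  rw [e4 b c, e4 b e, e4 c e]
  ring

/-- If `b` and `c` are the scaled edges issuing from a vertex of a small curvature line
quadrilateral, then its scaled diagonal is nearly concircular to them. -/
lemma circlePower_diagonal_bound (X Y P Q w r : E3) (h1 : dot3 X Y = 0)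
    (h2 : dot3 P Y + dot3 X w = 0) (h3 : dot3 Q X + dot3 Y w = 0) (K : ℝ) :
    ∃ K', ∀ ε : ℝ, 0 ≤ ε → ε ≤ 1 → ∀ b₂ c₂ e₃ : E3, ‖b₂‖ ≤ K → ‖c₂‖ ≤ K → ‖e₃‖ ≤ K →
      ∀ b c m : E3, b = X + ε • ((1 / 2 : ℝ) • P + ε • b₂) →
        c = Y + ε • ((1 / 2 : ℝ) • Q + ε • c₂) → m = b + c + ε • (w + ε • (r + ε • e₃)) →
        |circlePower b c m| ≤ K' * ε ^ 2 := by
  let g : ℝ × (E3 × E3 × E3) → ℝ := fun z =>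
    let b' := (1 / 2 : ℝ) • P + z.1 • z.2.1
    let c' := (1 / 2 : ℝ) • Q + z.1 • z.2.2.1
    let b := X + z.1 • b'
    let c := Y + z.1 • c'
    let r' := r + z.1 • z.2.2.2
    let e' := w + z.1 • r'
    let h' := dot3 X c' + dot3 b' Y + z.1 * dot3 b' c'
    dot3 b b * dot3 c c * (2 * dot3 X z.2.2.1 + 2 * dot3 z.2.1 Y + 2 * dot3 b' c' +
        dot3 (b' + c') w + dot3 (b + c) r') +
      (-2 * z.1 * h' ^ 3 - 2 * z.1 * h' ^ 2 * dot3 (b + c) e' + gram b c * dot3 e' e' +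
        h' * (dot3 b b * dot3 c e' + dot3 c c * dot3 b e'))
  have hg : Continuous g := by
    simp only [g, gram, dot3, PiLp.add_apply, PiLp.smul_apply, smul_eq_mul]
    fun_prop
  obtain ⟨K', hK'⟩ := exists_bound_of_continuous hg K
  refine ⟨K', fun ε h0 h1' b₂ c₂ e₃ hb hc he b c m hbe hce hme => ?_⟩
  have hgv := hK' ε h0 h1' (b₂, c₂, e₃) (by simp [Prod.norm_def, hb, hc, he])
  have : circlePower b c m = g (ε, b₂, c₂, e₃) * ε ^ 2 := by
    rw [hme, circlePower_add]
    simp only [g]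
    rw [← hbe, ← hce]
    set b' := (1 / 2 : ℝ) • P + ε • b₂ with hb'
    set c' := (1 / 2 : ℝ) • Q + ε • c₂ with hc'
    set e' := w + ε • (r + ε • e₃) with he'
    have i1 : dot3 b c = ε * (dot3 X c' + dot3 b' Y + ε * dot3 b' c') := by
      rw [hbe, hce]
      simp only [dot3, PiLp.add_apply, PiLp.smul_apply, smul_eq_mul] at h1 ⊢
      linear_combination h1
    have i2 : 2 * dot3 b c + dot3 (b + c) (ε • e') = ε ^ 2 * (2 * dot3 X c₂ + 2 * dot3 b₂ Y +
        2 * dot3 b' c' + dot3 (b' + c') w + dot3 (b + c) (r + ε • e₃)) := by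
      rw [i1, he', hbe, hce, hb', hc']
      simp only [dot3, PiLp.add_apply, PiLp.smul_apply, smul_eq_mul] at h2 h3 ⊢
      linear_combination ε * h2 + ε * h3
    have i3 : ∀ z : E3, dot3 z (ε • e') = ε * dot3 z e' := by
      intro z; simp only [dot3, PiLp.smul_apply, smul_eq_mul]; ring
    have i4 : dot3 (ε • e') (ε • e') = ε ^ 2 * dot3 e' e' := by
      simp only [dot3, PiLp.smul_apply, smul_eq_mul]; ring
    rw [i2, i4, i3 b, i3 c, i3 (b + c), i1]
    ring
  rw [this, abs_mul, abs_of_nonneg (by positivity : 0 ≤ ε ^ 2)]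
  gcongr

lemma abs_det3_le (x y z : E3) : |det3 x y z| ≤ 6 * ‖x‖ * ‖y‖ * ‖z‖ := by
  have h : ∀ (v : E3) (i : Fin 3), |v i| ≤ ‖v‖ := fun v i => PiLp.norm_apply_le v i
  have t : ∀ i j k : Fin 3, |z i * (x j * y k)| ≤ ‖x‖ * ‖y‖ * ‖z‖ := by
    intro i j k
    rw [abs_mul, abs_mul]
    calc |z i| * (|x j| * |y k|) ≤ ‖z‖ * (‖x‖ * ‖y‖) := by gcongr <;> apply h
      _ = _ := by ring
  have e := fun i j k => abs_le.1 (t i j k)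
  rw [det3, abs_le]
  constructor <;> nlinarith [e 0 1 2, e 0 2 1, e 1 2 0, e 1 0 2, e 2 0 1, e 2 1 0]

lemma det3_increment_bound (X Y P Q w : E3) (h1 : det3 X Y w = 0) (K : ℝ) :
    ∃ K', ∀ ε : ℝ, 0 < ε → ε ≤ 1 → ∀ b₂ c₂ k₁ k₂ : E3, ‖b₂‖ ≤ K → ‖c₂‖ ≤ K → ‖k₁‖ ≤ K →
      ‖k₂‖ ≤ K → ∀ b c U W : E3, b = X + ε • ((1 / 2 : ℝ) • P + ε • b₂) →
        c = Y + ε • ((1 / 2 : ℝ) • Q + ε • c₂) → U = X + ε • (P + w + ε • k₁) →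
        W = Y + ε • (Q + w + ε • k₂) → ‖b‖ ≤ K → ‖c‖ ≤ K →
      ∀ (d₁ d₂ T : ℝ) (σ m m' : E3), |d₁| ≤ T → |d₂| ≤ T → ‖σ‖ ≤ K * ε ^ 2 * T →
        m - m' = ε ^ 2 • (d₁ • U + d₂ • W + σ) →
        |det3 b c m / ε ^ 3 - det3 b c m' / ε ^ 3 -
          (d₁ * (det3 X Y P / 2) + d₂ * (det3 X Y Q / 2))| ≤ K' * ε * T := by
  have swap : ∀ x y z : E3, det3 y x z = -det3 x y z := by intro x y z; simp only [det3]; ring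
  obtain ⟨K₁, hK₁⟩ := det3_tangent_bound X Y P Q w h1 K
  obtain ⟨K₂, hK₂⟩ := det3_tangent_bound Y X Q P w (by rw [swap, h1, neg_zero]) K
  refine ⟨K₁ + K₂ + 6 * K * K * K, fun ε h0 h1' b₂ c₂ k₁ k₂ hb₂ hc₂ hk₁ hk₂ b c U W hb hc hU hW
    hbK hcK d₁ d₂ T σ m m' hd₁ hd₂ hσ hm => ?_⟩
  have e1 := hK₁ ε h0.le h1' b₂ c₂ k₁ hb₂ hc₂ hk₁ b c U hb hc hU
  have e2 := hK₂ ε h0.le h1' c₂ b₂ k₂ hc₂ hb₂ hk₂ c b W hc hb hW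
  rw [swap b c, swap X Y, ← abs_neg] at e2
  have hK : 0 ≤ K := (norm_nonneg _).trans hb₂
  have hT : 0 ≤ T := (abs_nonneg _).trans hd₁
  have e3 : |det3 b c σ| ≤ 6 * K * K * (K * ε ^ 2 * T) :=
    (abs_det3_le b c σ).trans (by gcongr)
  have hlin : det3 b c m - det3 b c m' =
      ε ^ 2 * (d₁ * det3 b c U + d₂ * det3 b c W + det3 b c σ) := by
    have : det3 b c m - det3 b c m' = det3 b c (m - m') := by
      simp only [det3, PiLp.sub_apply]; ring
    rw [this, hm]
    simp only [det3, PiLp.add_apply, PiLp.smul_apply, smul_eq_mul]; ring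
  have hε : ε ≠ 0 := h0.ne'
  have : det3 b c m / ε ^ 3 - det3 b c m' / ε ^ 3 -
      (d₁ * (det3 X Y P / 2) + d₂ * (det3 X Y Q / 2)) =
      (d₁ * (det3 b c U - ε * (det3 X Y P / 2)) +
        d₂ * (-(-det3 b c W - ε * (-det3 X Y Q / 2))) + det3 b c σ) / ε := by
    rw [← sub_div, hlin]
    field_simp
    ring
  rw [this, abs_div, abs_of_pos h0, div_le_iff₀ h0]
  calc _ ≤ |d₁| * |det3 b c U - ε * (det3 X Y P / 2)| +
        |d₂| * |(-(-det3 b c W - ε * (-det3 X Y Q / 2)))| + |det3 b c σ| := by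
        rw [← abs_mul, ← abs_mul]; exact abs_add_three _ _ _
    _ ≤ T * (K₁ * ε ^ 2) + T * (K₂ * ε ^ 2) + 6 * K * K * (K * ε ^ 2 * T) := by
        gcongr
    _ = _ := by ring

lemma circlePower_increment_bound (X Y : E3) (h1 : dot3 X Y = 0) (K : ℝ) :
    ∃ K', ∀ ε : ℝ, 0 < ε → ε ≤ 1 → ∀ b c U W m m' σ : E3, ‖b - X‖ ≤ K * ε → ‖c - Y‖ ≤ K * ε →
      ‖U - X‖ ≤ K * ε → ‖W - Y‖ ≤ K * ε → ‖m - (X + Y)‖ ≤ K * ε → ‖m' - (X + Y)‖ ≤ K * ε →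
      |gram b c - ‖X‖ ^ 2 * ‖Y‖ ^ 2| ≤ K' * ε ∧
      ∀ d₁ d₂ T : ℝ, |d₁| ≤ T → |d₂| ≤ T → ‖σ‖ ≤ K * ε * T →
        m - m' = ε ^ 2 • (d₁ • U + d₂ • W + σ) →
        |circlePower b c m / ε ^ 2 - circlePower b c m' / ε ^ 2 -
          (d₁ * (‖X‖ ^ 2 * ‖Y‖ ^ 2 * ‖X‖ ^ 2) + d₂ * (‖X‖ ^ 2 * ‖Y‖ ^ 2 * ‖Y‖ ^ 2))|
            ≤ K' * ε * T := by
  let g : E3 × E3 × E3 × E3 → ℝ × E3 := fun z =>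
    (gram z.1 z.2.1, gram z.1 z.2.1 • (z.2.2.1 + z.2.2.2) - scaledDiameter z.1 z.2.1)
  have hg : ContDiff ℝ 1 g := by
    simp only [g, gram, dot3, scaledDiameter]
    fun_prop
  obtain ⟨L, hL⟩ := exists_lipschitz_bound hg (X, Y, X + Y, X + Y) K
  set κ := ‖X‖ ^ 2 * ‖Y‖ ^ 2 with hκ
  set V₀ : E3 := κ • (X + Y) with hV₀
  have hg0 : g (X, Y, X + Y, X + Y) = (κ, V₀) := by
    simp only [g, gram, scaledDiameter, h1, dot3_self]
    ext1
    · simp [hκ]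
    · simp only [hV₀, hκ]; module
  have hX : dot3 X V₀ = κ * ‖X‖ ^ 2 := by
    rw [← dot3_self X]
    simp only [hV₀, dot3, PiLp.add_apply, PiLp.smul_apply, smul_eq_mul] at h1 ⊢
    linear_combination κ * h1
  have hY : dot3 Y V₀ = κ * ‖Y‖ ^ 2 := by
    rw [← dot3_self Y]
    simp only [hV₀, dot3, PiLp.add_apply, PiLp.smul_apply, smul_eq_mul] at h1 ⊢
    linear_combination κ * h1
  refine ⟨|L| * K + (‖X‖ + ‖Y‖) * (|L| * K) + 3 * K * (‖V₀‖ + |L| * K),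
    fun ε h0 h1' b c U W m m' σ hb hc hU hW hm hm' => ?_⟩
  have hK : 0 ≤ K := nonneg_of_mul_nonneg_left ((norm_nonneg _).trans hb) h0
  have hz : ‖(b, c, m, m') - (X, Y, X + Y, X + Y)‖ ≤ K * ε := by
    simp [Prod.norm_def, hb, hc, hm, hm']
  have hz1 := hL (b, c, m, m') (hz.trans (by nlinarith))
  rw [hg0] at hz1
  have hz2 : ‖g (b, c, m, m') - (κ, V₀)‖ ≤ |L| * K * ε := by
    calc _ ≤ _ := hz1
      _ ≤ |L| * (K * ε) := by gcongr; exact le_abs_self L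
      _ = _ := by ring
  set V := gram b c • (m + m') - scaledDiameter b c with hV
  have hgram : |gram b c - κ| ≤ |L| * K * ε := (norm_fst_le _).trans hz2
  have hVV : ‖V - V₀‖ ≤ |L| * K * ε := (norm_snd_le _).trans hz2
  have hVn : ‖V‖ ≤ ‖V₀‖ + |L| * K := by
    calc ‖V‖ = ‖V₀ + (V - V₀)‖ := by congr 1; abel
      _ ≤ ‖V₀‖ + |L| * K * ε := (norm_add_le _ _).trans (by gcongr)
      _ ≤ ‖V₀‖ + |L| * K * 1 := by gcongr
      _ = _ := by ring
  refine ⟨hgram.trans ?_, fun d₁ d₂ T hd₁ hd₂ hσ hmm => ?_⟩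
  · gcongr
    rw [add_assoc]
    exact le_add_of_nonneg_right (by positivity)
  have hT : 0 ≤ T := (abs_nonneg _).trans hd₁
  have hlin : circlePower b c m - circlePower b c m' =
      ε ^ 2 * (d₁ * dot3 U V + d₂ * dot3 W V + dot3 σ V) := by
    have : circlePower b c m - circlePower b c m' = dot3 (m - m') V := by
      simp only [hV, circlePower]
      generalize gram b c = t
      generalize scaledDiameter b c = s
      simp only [dot3, PiLp.sub_apply, PiLp.add_apply, PiLp.smul_apply, smul_eq_mul]; ring
    rw [this, hmm]
    generalize V = V'
    simp only [dot3, PiLp.add_apply, PiLp.smul_apply, smul_eq_mul]; ring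
  have hdot : ∀ Z Z₀ : E3, ‖Z - Z₀‖ ≤ K * ε → |dot3 Z V - dot3 Z₀ V₀| ≤
      K * ε * (‖V₀‖ + |L| * K) + ‖Z₀‖ * (|L| * K * ε) := by
    intro Z Z₀ hZ
    have : dot3 Z V - dot3 Z₀ V₀ = dot3 (Z - Z₀) V + dot3 Z₀ (V - V₀) := by
      generalize V = V'
      simp only [dot3, PiLp.sub_apply]; ring
    rw [this]
    refine (abs_add_le _ _).trans (add_le_add ?_ ?_)
    · exact (abs_dot3_le _ _).trans (by gcongr)
    · exact (abs_dot3_le _ _).trans (by gcongr)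
  have : circlePower b c m / ε ^ 2 - circlePower b c m' / ε ^ 2 -
      (d₁ * (κ * ‖X‖ ^ 2) + d₂ * (κ * ‖Y‖ ^ 2)) =
      d₁ * (dot3 U V - dot3 X V₀) + d₂ * (dot3 W V - dot3 Y V₀) + dot3 σ V := by
    rw [← sub_div, hlin, hX, hY]
    have hε : ε ≠ 0 := h0.ne'
    field_simp
    ring
  rw [this]
  calc _ ≤ |d₁| * |dot3 U V - dot3 X V₀| + |d₂| * |dot3 W V - dot3 Y V₀| + |dot3 σ V| := by
        rw [← abs_mul, ← abs_mul]; exact abs_add_three _ _ _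
    _ ≤ T * (K * ε * (‖V₀‖ + |L| * K) + ‖X‖ * (|L| * K * ε)) +
        T * (K * ε * (‖V₀‖ + |L| * K) + ‖Y‖ * (|L| * K * ε)) +
        (K * ε * T) * (‖V₀‖ + |L| * K) := by
        gcongr
        · exact hdot U X hU
        · exact hdot W Y hW
        · exact (abs_dot3_le _ _).trans (by gcongr)
    _ ≤ _ := by
        have : 0 ≤ |L| * K * ε * T := by positivity
        nlinarith

/-- The derivative of `g` in the direction `d`. -/
def dirDeriv (d : ℝ × ℝ) (g : ℝ × ℝ → E3) (p : ℝ × ℝ) : E3 := fderiv ℝ g p d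

lemma contDiffOn_dirDeriv {Ω : Set (ℝ × ℝ)} (hΩ : IsOpen Ω) {g : ℝ × ℝ → E3}
    (hg : ContDiffOn ℝ (⊤ : ℕ∞) g Ω) (d : ℝ × ℝ) : ContDiffOn ℝ (⊤ : ℕ∞) (dirDeriv d g) Ω :=
  (hg.fderiv_of_isOpen hΩ (by simp)).clm_apply contDiffOn_const

lemma ContDiffOn.differentiableAt_of_isOpen {Ω : Set (ℝ × ℝ)} (hΩ : IsOpen Ω) {g : ℝ × ℝ → E3}
    (hg : ContDiffOn ℝ (⊤ : ℕ∞) g Ω) {p : ℝ × ℝ} (hp : p ∈ Ω) : DifferentiableAt ℝ g p :=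
  (hg.contDiffAt (hΩ.mem_nhds hp)).differentiableAt (by simp)

lemma dirDeriv_congr {Ω : Set (ℝ × ℝ)} (hΩ : IsOpen Ω) {g g' : ℝ × ℝ → E3}
    (h : Set.EqOn g g' Ω) (d : ℝ × ℝ) : Set.EqOn (dirDeriv d g) (dirDeriv d g') Ω := by
  intro p hp
  have : g =ᶠ[nhds p] g' := Filter.eventuallyEq_of_mem (hΩ.mem_nhds hp) h
  simp only [dirDeriv, this.fderiv_eq]

lemma dirDeriv_comm {Ω : Set (ℝ × ℝ)} (hΩ : IsOpen Ω) {g : ℝ × ℝ → E3}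
    (hg : ContDiffOn ℝ (⊤ : ℕ∞) g Ω) (d d' : ℝ × ℝ) :
    Set.EqOn (dirDeriv d (dirDeriv d' g)) (dirDeriv d' (dirDeriv d g)) Ω := by
  intro p hp
  have hs := (hg.contDiffAt (hΩ.mem_nhds hp)).isSymmSndFDerivAt (by simp; norm_cast)
  have hd : DifferentiableAt ℝ (fderiv ℝ g) p :=
    ((hg.fderiv_of_isOpen (m := 1) hΩ (by norm_cast)).contDiffAt (hΩ.mem_nhds hp)).differentiableAt
      (by simp)
  have key : ∀ a b : ℝ × ℝ, dirDeriv a (dirDeriv b g) p = fderiv ℝ (fderiv ℝ g) p a b := by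
    intro a b
    change fderiv ℝ (fun q => fderiv ℝ g q b) p a = _
    rw [fderiv_clm_apply hd (by fun_prop)]
    simp
  rw [key, key, hs]

lemma dirDeriv_add {Ω : Set (ℝ × ℝ)} (hΩ : IsOpen Ω) {g g' : ℝ × ℝ → E3}
    (hg : ContDiffOn ℝ (⊤ : ℕ∞) g Ω) (hg' : ContDiffOn ℝ (⊤ : ℕ∞) g' Ω) (d : ℝ × ℝ) :
    Set.EqOn (dirDeriv d (g + g')) (dirDeriv d g + dirDeriv d g') Ω := by
  intro p hp
  simp only [dirDeriv, Pi.add_apply]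
  rw [fderiv_add (hg.differentiableAt_of_isOpen hΩ hp) (hg'.differentiableAt_of_isOpen hΩ hp)]
  rfl

/-- Taylor's formula along the line with direction `d`. -/
lemma taylor_dirDeriv {Ω : Set (ℝ × ℝ)} (hΩ : IsOpen Ω) {p : ℝ × ℝ} (hp : p ∈ Ω) (d : ℝ × ℝ)
    (n : ℕ) : ∀ g : ℝ × ℝ → E3, ContDiffOn ℝ (⊤ : ℕ∞) g Ω →
    ∃ δ > (0 : ℝ), ∃ K : ℝ, ∀ t ∈ Set.Icc 0 δ, p + t • d ∈ Ω ∧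
      ‖g (p + t • d) - ∑ k ∈ Finset.range n, (t ^ k / k.factorial) • ((dirDeriv d)^[k] g) p‖
        ≤ K * t ^ n := by
  have hline : Continuous fun t : ℝ => p + t • d := by fun_prop
  obtain ⟨δ₀, hδ₀, hball⟩ : ∃ δ₀ > (0 : ℝ), ∀ t ∈ Set.Icc 0 δ₀, p + t • d ∈ Ω := by
    have : ∀ᶠ t in nhds (0 : ℝ), p + t • d ∈ Ω :=
      hline.continuousAt.eventually_mem (by simpa using hΩ.mem_nhds hp)
    obtain ⟨δ₀, hδ₀, h⟩ := Metric.eventually_nhds_iff.1 this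
    refine ⟨δ₀ / 2, by positivity, fun t ht => h ?_⟩
    rw [Real.dist_0_eq_abs, abs_of_nonneg ht.1]
    linarith [ht.2]
  induction n with
  | zero =>
    intro g hg
    have hc : ContinuousOn (fun t : ℝ => g (p + t • d)) (Set.Icc 0 δ₀) :=
      hg.continuousOn.comp hline.continuousOn hball
    obtain ⟨K, hK⟩ := isCompact_Icc.exists_bound_of_continuousOn hc
    exact ⟨δ₀, hδ₀, K, fun t ht => ⟨hball t ht, by simpa using hK t ht⟩⟩
  | succ n ih =>
    intro g hg
    obtain ⟨δ, hδ, K, hK⟩ := ih (dirDeriv d g) (contDiffOn_dirDeriv hΩ hg d)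
    have hK0 : 0 ≤ K := by
      have := (norm_nonneg _).trans (hK δ ⟨hδ.le, le_rfl⟩).2
      exact nonneg_of_mul_nonneg_left this (by positivity)
    refine ⟨δ, hδ, K, fun t ht => ⟨(hK t ht).1, ?_⟩⟩
    let ψ : ℝ → E3 := fun s => g (p + s • d) -
      ∑ k ∈ Finset.range (n + 1), (s ^ k / k.factorial) • ((dirDeriv d)^[k] g) p
    have hψ : ∀ s ∈ Set.Icc 0 δ, HasDerivAt ψ (dirDeriv d g (p + s • d) -
        ∑ k ∈ Finset.range n, (s ^ k / k.factorial) • ((dirDeriv d)^[k] (dirDeriv d g)) p) s := by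
      intro s hs
      have h1 : HasDerivAt (fun s : ℝ => g (p + s • d)) (dirDeriv d g (p + s • d)) s := by
        have hl : HasDerivAt (fun s : ℝ => p + s • d) d s := by
          simpa using ((hasDerivAt_id s).smul_const d).const_add p
        exact (hg.differentiableAt_of_isOpen hΩ (hK s hs).1).hasFDerivAt.comp_hasDerivAt s hl
      have h2 : ∀ k ∈ Finset.range n, HasDerivAt
          (fun s : ℝ => (s ^ (k + 1) / (k + 1).factorial) • ((dirDeriv d)^[k + 1] g) p)
          ((s ^ k / k.factorial) • ((dirDeriv d)^[k] (dirDeriv d g)) p) s := by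
        intro k _
        rw [Function.iterate_succ_apply]
        refine HasDerivAt.smul_const ?_ _
        convert (hasDerivAt_pow (k + 1) s).div_const ((k + 1).factorial : ℝ) using 1
        rw [Nat.factorial_succ]
        push_cast
        have : (k.factorial : ℝ) ≠ 0 := by positivity
        have : (k : ℝ) + 1 ≠ 0 := by positivity
        field_simp
      have h3 := h1.sub ((HasDerivAt.fun_sum h2).add_const (g p))
      refine h3.congr_of_eventuallyEq (Filter.Eventually.of_forall fun s => ?_)
      simp [ψ, Finset.sum_range_succ']
    have h0 : ψ 0 = 0 := by
      simp [ψ, Finset.sum_range_succ']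
    have := norm_image_sub_le_of_norm_deriv_le_segment' (f := ψ) (a := 0) (b := t) (C := K * t ^ n)
      (fun s hs => (hψ s ⟨hs.1, hs.2.trans ht.2⟩).hasDerivWithinAt)
      (fun s hs => (hK s ⟨hs.1, hs.2.le.trans ht.2⟩).2.trans (by
        have := hs.1; have := hs.2.le; gcongr))
      t ⟨ht.1, le_rfl⟩
    rw [h0, sub_zero, sub_zero] at this
    calc _ = ‖ψ t‖ := rfl
      _ ≤ _ := this
      _ = _ := by ring

/-- An approximately linear map of the plane with bounded value at the origin has a zero. -/
lemma exists_zero_of_approx_linear {a₁ a₂ b₁ b₂ : ℝ} (hdet : a₁ * b₂ - a₂ * b₁ ≠ 0) (K : ℝ) :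
    ∃ R > (0 : ℝ), ∃ η > (0 : ℝ), ∀ Φ : ℝ × ℝ → ℝ × ℝ, ‖Φ 0‖ ≤ K →
      (∀ x ∈ closedBall (0 : ℝ × ℝ) R, ∀ y ∈ closedBall (0 : ℝ × ℝ) R,
        |(Φ x).1 - (Φ y).1 - ((x - y).1 * a₁ + (x - y).2 * a₂)| ≤ η * ‖x - y‖ ∧
        |(Φ x).2 - (Φ y).2 - ((x - y).1 * b₁ + (x - y).2 * b₂)| ≤ η * ‖x - y‖) →
      ∃ x ∈ closedBall (0 : ℝ × ℝ) R, Φ x = 0 := by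
  let l : ℝ × ℝ →ₗ[ℝ] ℝ × ℝ :=
    { toFun := fun x => (x.1 * a₁ + x.2 * a₂, x.1 * b₁ + x.2 * b₂)
      map_add' := fun x y => by ext <;> simp <;> ring
      map_smul' := fun x y => by ext <;> simp <;> ring }
  have hinj : Function.Injective l := by
    rw [injective_iff_map_eq_zero]
    intro x hx
    have e1 : x.1 * a₁ + x.2 * a₂ = 0 := congrArg Prod.fst hx
    have e2 : x.1 * b₁ + x.2 * b₂ = 0 := congrArg Prod.snd hx
    ext
    · exact (mul_eq_zero.1 (show (a₁ * b₂ - a₂ * b₁) * x.1 = 0 by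
        linear_combination b₂ * e1 - a₂ * e2)).resolve_left hdet
    · exact (mul_eq_zero.1 (show (a₁ * b₂ - a₂ * b₁) * x.2 = 0 by
        linear_combination a₁ * e2 - b₁ * e1)).resolve_left hdet
  let L : (ℝ × ℝ) ≃L[ℝ] ℝ × ℝ := (LinearEquiv.ofInjectiveEndo l hinj).toContinuousLinearEquiv
  have hL : ∀ x, L x = (x.1 * a₁ + x.2 * a₂, x.1 * b₁ + x.2 * b₂) := fun x => rfl
  let N : NNReal := L.toNonlinearRightInverse.nnnorm
  have hN : 0 < (N : ℝ) := L.nnnorm_symm_pos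
  refine ⟨2 * N * (|K| + 1), by positivity, (N : ℝ)⁻¹ / 2, by positivity, fun Φ h0 hΦ => ?_⟩
  have happ : ApproximatesLinearOn Φ (L : ℝ × ℝ →L[ℝ] ℝ × ℝ)
      (closedBall 0 (2 * N * (|K| + 1))) (N⁻¹ / 2) := by
    intro x hx y hy
    obtain ⟨h1, h2⟩ := hΦ x hx y hy
    rw [Prod.norm_def]
    refine max_le ?_ ?_
    · simpa [hL] using h1
    · simpa [hL] using h2
  have hsurj := happ.surjOn_closedBall_of_nonlinearRightInverse L.toNonlinearRightInverse
    (b := 0) (ε := 2 * N * (|K| + 1)) (by positivity) subset_rfl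
  have hmem : (0 : ℝ × ℝ) ∈ closedBall (Φ 0)
      (((N : ℝ)⁻¹ - ((N⁻¹ / 2 : NNReal) : ℝ)) * (2 * N * (|K| + 1))) := by
    rw [mem_closedBall, dist_zero_left]
    have : ((N : ℝ)⁻¹ - ((N⁻¹ / 2 : NNReal) : ℝ)) * (2 * N * (|K| + 1)) = |K| + 1 := by
      push_cast
      field_simp
      ring
    rw [this]
    linarith [le_abs_self K]
  obtain ⟨x, hx, hx0⟩ := hsurj hmem
  exact ⟨x, hx, hx0⟩

lemma hasDerivAt_coord {x : ℝ → E3} {x' : E3} {t : ℝ} (hx : HasDerivAt x x' t) (i : Fin 3) :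
    HasDerivAt (fun s => x s i) (x' i) t :=
  (EuclideanSpace.proj i : E3 →L[ℝ] ℝ).hasFDerivAt.comp_hasDerivAt t hx

lemma hasDerivAt_dot3 {x y : ℝ → E3} {x' y' : E3} {t : ℝ} (hx : HasDerivAt x x' t)
    (hy : HasDerivAt y y' t) :
    HasDerivAt (fun s => dot3 (x s) (y s)) (dot3 x' (y t) + dot3 (x t) y') t := by
  have X := hasDerivAt_coord hx
  have Y := hasDerivAt_coord hy
  refine ((((X 0).mul (Y 0)).add ((X 1).mul (Y 1))).add ((X 2).mul (Y 2))).congr_deriv ?_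
  simp only [dot3]; ring

lemma hasDerivAt_det3 {x y z : ℝ → E3} {x' y' z' : E3} {t : ℝ} (hx : HasDerivAt x x' t)
    (hy : HasDerivAt y y' t) (hz : HasDerivAt z z' t) :
    HasDerivAt (fun s => det3 (x s) (y s) (z s))
      (det3 x' (y t) (z t) + det3 (x t) y' (z t) + det3 (x t) (y t) z') t := by
  have X := hasDerivAt_coord hx
  have Y := hasDerivAt_coord hy
  have Z := hasDerivAt_coord hz
  refine ((((Z 0).mul (((X 1).mul (Y 2)).sub ((X 2).mul (Y 1)))).add
    ((Z 1).mul (((X 2).mul (Y 0)).sub ((X 0).mul (Y 2))))).add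
    ((Z 2).mul (((X 0).mul (Y 1)).sub ((X 1).mul (Y 0))))).congr_deriv ?_
  simp only [det3, Pi.mul_apply, Pi.sub_apply]; ring

lemma hasDerivAt_line {Ω : Set (ℝ × ℝ)} (hΩ : IsOpen Ω) {g : ℝ × ℝ → E3}
    (hg : ContDiffOn ℝ (⊤ : ℕ∞) g Ω) {p : ℝ × ℝ} (hp : p ∈ Ω) (d : ℝ × ℝ) :
    HasDerivAt (fun t : ℝ => g (p + t • d)) (dirDeriv d g p) 0 := by
  have hl : HasDerivAt (fun s : ℝ => p + s • d) d 0 := by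
    simpa using ((hasDerivAt_id (0 : ℝ)).smul_const d).const_add p
  have hf := (hg.differentiableAt_of_isOpen hΩ hp).hasFDerivAt
  exact HasFDerivAt.comp_hasDerivAt 0 (by simpa using hf) hl

lemma deriv_line_eq_zero {Ω : Set (ℝ × ℝ)} (hΩ : IsOpen Ω) {G : ℝ × ℝ → ℝ}
    (hG : ∀ q ∈ Ω, G q = 0) {p : ℝ × ℝ} (hp : p ∈ Ω) {d : ℝ × ℝ} {G' : ℝ}
    (h : HasDerivAt (fun t : ℝ => G (p + t • d)) G' 0) : G' = 0 := by
  have hline : Continuous fun t : ℝ => p + t • d := by fun_prop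
  have hev : ∀ᶠ t in nhds (0 : ℝ), p + t • d ∈ Ω :=
    hline.continuousAt.eventually_mem (by simpa using hΩ.mem_nhds hp)
  exact h.unique ((hasDerivAt_const (0 : ℝ) (0 : ℝ)).congr_of_eventuallyEq
    (hev.mono fun t ht => hG _ ht))

/-- The relations between the partial derivatives up to order three of a surface parametrized by
curvature lines. -/
lemma curvature_line_relations {Ω : Set (ℝ × ℝ)} (hΩ : IsOpen Ω) {f : ℝ × ℝ → E3}
    (hf : ContDiffOn ℝ (⊤ : ℕ∞) f Ω)
    (horth : ∀ p ∈ Ω, dot3 (pd1 f p) (pd2 f p) = 0)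
    (hconj : ∀ p ∈ Ω, pd2 (pd1 f) p ∈ Submodule.span ℝ ({pd1 f p, pd2 f p} : Set E3))
    {p : ℝ × ℝ} (hp : p ∈ Ω) :
    det3 (pd1 f p) (pd2 f p) (pd2 (pd1 f) p) = 0 ∧
    det3 (pd1 (pd1 f) p) (pd2 f p) (pd2 (pd1 f) p) +
      det3 (pd1 f p) (pd2 (pd2 f) p) (pd2 (pd1 f) p) +
      2 * det3 (pd1 f p) (pd2 f p)
        ((1 / 2 : ℝ) • (pd2 (pd1 (pd1 f)) p + pd2 (pd2 (pd1 f)) p)) = 0 ∧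
    dot3 (pd1 (pd1 f) p) (pd2 f p) + dot3 (pd1 f p) (pd2 (pd1 f) p) = 0 ∧
    dot3 (pd2 (pd2 f) p) (pd1 f p) + dot3 (pd2 f p) (pd2 (pd1 f) p) = 0 := by
  have h1 := contDiffOn_dirDeriv hΩ hf (1, 0)
  have h2 := contDiffOn_dirDeriv hΩ hf (0, 1)
  have h21 := contDiffOn_dirDeriv hΩ h1 (0, 1)
  have hplane : ∀ q ∈ Ω, det3 (dirDeriv (1, 0) f q) (dirDeriv (0, 1) f q)
      (dirDeriv (0, 1) (dirDeriv (1, 0) f) q) = 0 := by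
    intro q hq
    obtain ⟨s, t, hst⟩ := Submodule.mem_span_pair.1 (hconj q hq)
    change det3 (pd1 f q) (pd2 f q) (pd2 (pd1 f) q) = 0
    rw [← hst]
    simp only [det3, PiLp.add_apply, PiLp.smul_apply, smul_eq_mul]; ring
  have hcomm : dirDeriv (1, 0) (dirDeriv (0, 1) f) p = dirDeriv (0, 1) (dirDeriv (1, 0) f) p :=
    dirDeriv_comm hΩ hf _ _ hp
  have hcomm' : dirDeriv (1, 0) (dirDeriv (0, 1) (dirDeriv (1, 0) f)) p =
      dirDeriv (0, 1) (dirDeriv (1, 0) (dirDeriv (1, 0) f)) p := dirDeriv_comm hΩ h1 _ _ hp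
  have hp0 := hplane p hp
  have dU := deriv_line_eq_zero hΩ hplane hp
    (hasDerivAt_det3 (hasDerivAt_line hΩ h1 hp (1, 0)) (hasDerivAt_line hΩ h2 hp (1, 0))
      (hasDerivAt_line hΩ h21 hp (1, 0)))
  have dV := deriv_line_eq_zero hΩ hplane hp
    (hasDerivAt_det3 (hasDerivAt_line hΩ h1 hp (0, 1)) (hasDerivAt_line hΩ h2 hp (0, 1))
      (hasDerivAt_line hΩ h21 hp (0, 1)))
  have oU := deriv_line_eq_zero hΩ horth hp
    (hasDerivAt_dot3 (hasDerivAt_line hΩ h1 hp (1, 0)) (hasDerivAt_line hΩ h2 hp (1, 0)))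
  have oV := deriv_line_eq_zero hΩ horth hp
    (hasDerivAt_dot3 (hasDerivAt_line hΩ h1 hp (0, 1)) (hasDerivAt_line hΩ h2 hp (0, 1)))
  simp only [zero_smul, add_zero, hcomm, hcomm'] at dU dV oU oV
  refine ⟨hp0, ?_, oU, ?_⟩
  · change det3 (dirDeriv (1, 0) (dirDeriv (1, 0) f) p) (dirDeriv (0, 1) f p)
        (dirDeriv (0, 1) (dirDeriv (1, 0) f) p) +
      det3 (dirDeriv (1, 0) f p) (dirDeriv (0, 1) (dirDeriv (0, 1) f) p)
        (dirDeriv (0, 1) (dirDeriv (1, 0) f) p) +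
      2 * det3 (dirDeriv (1, 0) f p) (dirDeriv (0, 1) f p)
        ((1 / 2 : ℝ) • (dirDeriv (0, 1) (dirDeriv (1, 0) (dirDeriv (1, 0) f)) p +
          dirDeriv (0, 1) (dirDeriv (0, 1) (dirDeriv (1, 0) f)) p)) = 0
    simp only [det3, PiLp.add_apply, PiLp.smul_apply, smul_eq_mul] at dU dV ⊢
    linear_combination dU + dV
  · change dot3 (dirDeriv (0, 1) (dirDeriv (0, 1) f) p) (pd1 f p) +
      dot3 (pd2 f p) (dirDeriv (0, 1) (dirDeriv (1, 0) f) p) = 0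
    simp only [dot3] at oV ⊢
    linear_combination oV

lemma dirDeriv_one_one (g : ℝ × ℝ → E3) :
    dirDeriv (1, 1) g = dirDeriv (1, 0) g + dirDeriv (0, 1) g := by
  ext1 p
  simp only [dirDeriv, Pi.add_apply, ← map_add]
  simp

lemma exists_taylor_remainder {Ω : Set (ℝ × ℝ)} (hΩ : IsOpen Ω) {p : ℝ × ℝ} (hp : p ∈ Ω)
    (d : ℝ × ℝ) (n : ℕ) {g : ℝ × ℝ → E3} (hg : ContDiffOn ℝ (⊤ : ℕ∞) g Ω) :
    ∃ δ > (0 : ℝ), ∃ K : ℝ, ∀ t : ℝ, 0 < t → t ≤ δ → ∃ ρ : E3, ‖ρ‖ ≤ K ∧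
      g (p + t • d) =
        ∑ k ∈ Finset.range n, (t ^ k / k.factorial) • ((dirDeriv d)^[k] g) p + t ^ n • ρ := by
  obtain ⟨δ, hδ, K, hK⟩ := taylor_dirDeriv hΩ hp d n g hg
  refine ⟨δ, hδ, K, fun t ht0 ht => ⟨(t ^ n)⁻¹ • (g (p + t • d) -
    ∑ k ∈ Finset.range n, (t ^ k / k.factorial) • ((dirDeriv d)^[k] g) p), ?_, ?_⟩⟩
  · rw [norm_smul, norm_inv, Real.norm_of_nonneg (by positivity : 0 ≤ t ^ n),
      inv_mul_le_iff₀ (by positivity), mul_comm]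
    exact (hK t ⟨ht0.le, ht⟩).2
  · rw [smul_inv_smul₀ (by positivity)]
    abel

/-- Taylor expansions of the vertices of a small coordinate quadrilateral and of the tangent
vectors at the vertex opposite to the base point. -/
lemma exists_quad_expansion {Ω : Set (ℝ × ℝ)} (hΩ : IsOpen Ω) {f : ℝ × ℝ → E3}
    (hf : ContDiffOn ℝ (⊤ : ℕ∞) f Ω) {p : ℝ × ℝ} (hp : p ∈ Ω) :
    ∃ δ > (0 : ℝ), ∃ K : ℝ, ∀ ε : ℝ, 0 < ε → ε ≤ δ → ∃ b₂ c₂ e₃ k₁ k₂ : E3,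
      ‖b₂‖ ≤ K ∧ ‖c₂‖ ≤ K ∧ ‖e₃‖ ≤ K ∧ ‖k₁‖ ≤ K ∧ ‖k₂‖ ≤ K ∧
      ∃ b c : E3, b = pd1 f p + ε • ((1 / 2 : ℝ) • pd1 (pd1 f) p + ε • b₂) ∧
        c = pd2 f p + ε • ((1 / 2 : ℝ) • pd2 (pd2 f) p + ε • c₂) ∧
        f (p + ε • (1, 0)) - f p = ε • b ∧ f (p + ε • (0, 1)) - f p = ε • c ∧
        f (p + ε • (1, 1)) - f p = ε • (b + c + ε • (pd2 (pd1 f) p +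
          ε • ((1 / 2 : ℝ) • (pd2 (pd1 (pd1 f)) p + pd2 (pd2 (pd1 f)) p) + ε • e₃))) ∧
        pd1 f (p + ε • (1, 1)) = pd1 f p + ε • (pd1 (pd1 f) p + pd2 (pd1 f) p + ε • k₁) ∧
        pd2 f (p + ε • (1, 1)) = pd2 f p + ε • (pd2 (pd2 f) p + pd2 (pd1 f) p + ε • k₂) := by
  have h1 := contDiffOn_dirDeriv hΩ hf (1, 0)
  have h2 := contDiffOn_dirDeriv hΩ hf (0, 1)
  have h11 := contDiffOn_dirDeriv hΩ h1 (1, 0)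
  have h21 := contDiffOn_dirDeriv hΩ h1 (0, 1)
  have h22 := contDiffOn_dirDeriv hΩ h2 (0, 1)
  set f1 := dirDeriv (1, 0) f with hf1
  set f2 := dirDeriv (0, 1) f with hf2
  set f11 := dirDeriv (1, 0) f1 with hf11
  set f21 := dirDeriv (0, 1) f1 with hf21
  set f22 := dirDeriv (0, 1) f2 with hf22
  have hcomm : Set.EqOn (dirDeriv (1, 0) f2) f21 Ω := dirDeriv_comm hΩ hf _ _
  have hsecond : Set.EqOn (dirDeriv (1, 1) (dirDeriv (1, 1) f)) ((f11 + f21) + (f21 + f22)) Ω := by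
    intro q hq
    have a1 : dirDeriv (1, 0) (f1 + f2) q = _ := dirDeriv_add hΩ h1 h2 _ hq
    have a2 : dirDeriv (0, 1) (f1 + f2) q = _ := dirDeriv_add hΩ h1 h2 _ hq
    rw [dirDeriv_one_one f, dirDeriv_one_one, Pi.add_apply, a1, a2]
    simp only [Pi.add_apply, hcomm hq]
    rfl
  have hthird : dirDeriv (1, 1) (dirDeriv (1, 1) (dirDeriv (1, 1) f)) p =
      dirDeriv (1, 0) f11 p + (3 : ℝ) • dirDeriv (0, 1) f11 p + (3 : ℝ) • dirDeriv (0, 1) f21 p +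
        dirDeriv (0, 1) f22 p := by
    rw [dirDeriv_congr hΩ hsecond _ hp, dirDeriv_add (g := f11 + f21) (g' := f21 + f22) hΩ (h11.add h21)
      (h21.add h22) _ hp,
      Pi.add_apply, dirDeriv_add hΩ h11 h21 _ hp, dirDeriv_add hΩ h21 h22 _ hp]
    have c1 : dirDeriv (1, 0) f21 p = dirDeriv (0, 1) f11 p := dirDeriv_comm hΩ h1 _ _ hp
    have c2 : dirDeriv (1, 0) f22 p = dirDeriv (0, 1) f21 p :=
      (dirDeriv_comm hΩ h2 _ _ hp).trans (dirDeriv_congr hΩ hcomm _ hp)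
    simp only [dirDeriv_one_one, Pi.add_apply, c1, c2]
    module
  obtain ⟨δB, hδB, KB, hB⟩ := exists_taylor_remainder hΩ hp (1, 0) 4 hf
  obtain ⟨δC, hδC, KC, hC⟩ := exists_taylor_remainder hΩ hp (0, 1) 4 hf
  obtain ⟨δD, hδD, KD, hD⟩ := exists_taylor_remainder hΩ hp (1, 1) 4 hf
  obtain ⟨δU, hδU, KU, hU⟩ := exists_taylor_remainder hΩ hp (1, 1) 2 h1
  obtain ⟨δW, hδW, KW, hW⟩ := exists_taylor_remainder hΩ hp (1, 1) 2 h2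
  refine ⟨min 1 (min δB (min δC (min δD (min δU δW)))), by positivity,
    |KB| + |KC| + |KD| + |KU| + |KW| + ‖dirDeriv (1, 0) f11 p‖ + ‖dirDeriv (0, 1) f22 p‖,
    fun ε h0 hε => ?_⟩
  simp only [le_min_iff] at hε
  obtain ⟨hε1, hεB, hεC, hεD, hεU, hεW⟩ := hε
  obtain ⟨ρB, hρB, eB⟩ := hB ε h0 hεB
  obtain ⟨ρC, hρC, eC⟩ := hC ε h0 hεC
  obtain ⟨ρD, hρD, eD⟩ := hD ε h0 hεD
  obtain ⟨ρU, hρU, eU⟩ := hU ε h0 hεU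
  obtain ⟨ρW, hρW, eW⟩ := hW ε h0 hεW
  have nB := hρB.trans (le_abs_self _)
  have nC := hρC.trans (le_abs_self _)
  have nD := hρD.trans (le_abs_self _)
  have nU := hρU.trans (le_abs_self _)
  have nW := hρW.trans (le_abs_self _)
  have hcub : ∀ z ρ : E3, ‖(1 / 6 : ℝ) • z + ε • ρ‖ ≤ ‖z‖ + ‖ρ‖ := by
    intro z ρ
    refine (norm_add_le _ _).trans ?_
    rw [norm_smul, norm_smul, Real.norm_of_nonneg h0.le, Real.norm_of_nonneg (by norm_num)]
    nlinarith [norm_nonneg z, norm_nonneg ρ]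
  have p1 := norm_nonneg (dirDeriv (1, 0) f11 p)
  have p2 := norm_nonneg (dirDeriv (0, 1) f22 p)
  have q1 := abs_nonneg KB
  have q2 := abs_nonneg KC
  have q3 := abs_nonneg KD
  have q4 := abs_nonneg KU
  have q5 := abs_nonneg KW
  refine ⟨(1 / 6 : ℝ) • dirDeriv (1, 0) f11 p + ε • ρB,
    (1 / 6 : ℝ) • dirDeriv (0, 1) f22 p + ε • ρC, ρD - ρB - ρC, ρU, ρW,
    (hcub _ _).trans (by linarith), (hcub _ _).trans (by linarith), ?_, by linarith, by linarith,
    f1 p + ε • ((1 / 2 : ℝ) • f11 p + ε • ((1 / 6 : ℝ) • dirDeriv (1, 0) f11 p + ε • ρB)),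
    f2 p + ε • ((1 / 2 : ℝ) • f22 p + ε • ((1 / 6 : ℝ) • dirDeriv (0, 1) f22 p + ε • ρC)),
    rfl, rfl, ?_, ?_, ?_, ?_, ?_⟩
  · have := norm_sub_le (ρD - ρB) ρC
    have := norm_sub_le ρD ρB
    linarith
  · rw [eB]
    simp only [Finset.sum_range_succ, Finset.sum_range_zero, Function.iterate_succ_apply',
      Function.iterate_zero_apply, Nat.factorial, ← hf1, ← hf11]
    norm_num
    module
  · rw [eC]
    simp only [Finset.sum_range_succ, Finset.sum_range_zero, Function.iterate_succ_apply',
      Function.iterate_zero_apply, Nat.factorial, ← hf2, ← hf22]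
    norm_num
    module
  · rw [eD]
    simp only [Finset.sum_range_succ, Finset.sum_range_zero, Function.iterate_succ_apply',
      Function.iterate_zero_apply, Nat.factorial, hthird, hsecond hp]
    rw [dirDeriv_one_one f, Pi.add_apply, ← hf1, ← hf2]
    change _ = ε • (_ + ε • (f21 p + ε • ((1 / 2 : ℝ) • (dirDeriv (0, 1) f11 p +
      dirDeriv (0, 1) f21 p) + _)))
    simp only [Pi.add_apply]
    norm_num
    module
  · change f1 _ = f1 p + ε • (f11 p + f21 p + _)
    rw [eU]
    simp only [Finset.sum_range_succ, Finset.sum_range_zero, Function.iterate_succ_apply',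
      Function.iterate_zero_apply, Nat.factorial, dirDeriv_one_one f1, Pi.add_apply, ← hf11,
      ← hf21]
    norm_num
    module
  · change f2 _ = f2 p + ε • (f22 p + f21 p + _)
    rw [eW]
    simp only [Finset.sum_range_succ, Finset.sum_range_zero, Function.iterate_succ_apply',
      Function.iterate_zero_apply, Nat.factorial, dirDeriv_one_one f2, Pi.add_apply, ← hf22,
      hcomm hp]
    norm_num
    module

lemma exists_increment_bound {Ω : Set (ℝ × ℝ)} (hΩ : IsOpen Ω) {f : ℝ × ℝ → E3}
    (hf : ContDiffOn ℝ (⊤ : ℕ∞) f Ω) {p : ℝ × ℝ} (hp : p ∈ Ω) :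
    ∃ δ > (0 : ℝ), ∃ K : ℝ, 0 ≤ K ∧ ball p δ ⊆ Ω ∧
      (∀ y ∈ ball p δ, ∀ y' ∈ ball p δ, ‖f y - f y'‖ ≤ K * ‖y - y'‖) ∧
      ∀ (q : ℝ × ℝ) (ρ : ℝ), closedBall q ρ ⊆ ball p δ → ∀ y ∈ closedBall q ρ,
        ∀ y' ∈ closedBall q ρ, ‖f y - f y' - fderiv ℝ f q (y - y')‖ ≤ K * ρ * ‖y - y'‖ := by
  have hfp := hf.contDiffAt (hΩ.mem_nhds hp)
  obtain ⟨K₁, s₁, hs₁, hL₁⟩ := (hfp.of_le (by norm_cast)).exists_lipschitzOnWith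
  obtain ⟨K₂, s₂, hs₂, hL₂⟩ := (((hf.fderiv_of_isOpen (m := 1) hΩ (by norm_cast)).contDiffAt
    (hΩ.mem_nhds hp))).exists_lipschitzOnWith
  obtain ⟨δ, hδ, hball⟩ := Metric.mem_nhds_iff.1
    (Filter.inter_mem (hΩ.mem_nhds hp) (Filter.inter_mem hs₁ hs₂))
  refine ⟨δ, hδ, K₁ + K₂, by positivity, fun y hy => (hball hy).1, ?_, ?_⟩
  · intro y hy y' hy'
    refine (hL₁.norm_sub_le (hball hy).2.1 (hball hy').2.1).trans ?_
    gcongr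
    simp
  · intro q ρ hqρ y hy y' hy'
    have hρ : 0 ≤ ρ := dist_nonneg.trans hy
    refine (convex_closedBall q ρ).norm_image_sub_le_of_norm_fderiv_le'
      (fun x hx => hf.differentiableAt_of_isOpen hΩ (hball (hqρ hx)).1) (fun x hx => ?_) hy' hy
    refine (hL₂.norm_sub_le (hball (hqρ hx)).2.2
      (hball (hqρ (mem_closedBall_self hρ))).2.2).trans ?_
    rw [mem_closedBall, dist_eq_norm] at hx
    gcongr
    simp

lemma det3_smul (t : ℝ) (x y z : E3) : det3 (t • x) (t • y) (t • z) = t ^ 3 * det3 x y z := by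
  simp only [det3, PiLp.smul_apply, smul_eq_mul]; ring

lemma dot3_smul (s t : ℝ) (x y : E3) : dot3 (s • x) (t • y) = s * t * dot3 x y := by
  simp only [dot3, PiLp.smul_apply, smul_eq_mul]; ring

lemma gram_smul (t : ℝ) (b c : E3) : gram (t • b) (t • c) = t ^ 4 * gram b c := by
  simp only [gram, dot3_smul]; ring

lemma circlePower_smul (t : ℝ) (b c m : E3) :
    circlePower (t • b) (t • c) (t • m) = t ^ 6 * circlePower b c m := by
  have : scaledDiameter (t • b) (t • c) = t ^ 5 • scaledDiameter b c := by
    simp only [scaledDiameter, dot3_smul]; module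
  simp only [circlePower, gram_smul, this, dot3_smul]; ring

lemma det3_smul_norm_ne_of_princCurv_ne {f : ℝ × ℝ → E3} {p : ℝ × ℝ} (hX : pd1 f p ≠ 0)
    (hY : pd2 f p ≠ 0) (humb : princCurv1 f p ≠ princCurv2 f p) :
    det3 (pd1 f p) (pd2 f p) (pd1 (pd1 f) p) * ‖pd2 f p‖ ^ 2 ≠
      det3 (pd1 f p) (pd2 f p) (pd2 (pd2 f) p) * ‖pd1 f p‖ ^ 2 := by
  intro h
  apply humb
  have hX' := norm_ne_zero_iff.2 hX
  have hY' := norm_ne_zero_iff.2 hY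
  have hN : ∀ z : E3, dot3 z (unitNormal f p) =
      ‖cross3 (pd1 f p) (pd2 f p)‖⁻¹ * det3 (pd1 f p) (pd2 f p) z := by
    intro z
    rw [det3_eq_dot3_cross3, unitNormal]
    simp only [dot3, PiLp.smul_apply, smul_eq_mul]; ring
  rw [princCurv1, princCurv2, hN, hN, div_eq_div_iff (by positivity) (by positivity),
    mul_assoc, mul_assoc, h]

lemma fderiv_eq_pd (f : ℝ × ℝ → E3) (q z : ℝ × ℝ) :
    fderiv ℝ f q z = z.1 • pd1 f q + z.2 • pd2 f q := by
  rw [pd1, pd2, ← map_smul, ← map_smul, ← map_add]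
  simp

set_option maxHeartbeats 1600000 in
/-- For a smooth surface parametrized by curvature lines and a non-umbilic point `(u₀,v₀)`,
with `A = f(u₀,v₀)`, `B = f(u₀+ε,v₀)`, `C = f(u₀,v₀+ε)`, `D = f(u₀+ε,v₀+ε)`, there is a
point `M` lying both on the circle through `A`, `B`, `C` and in the image `f(Ω)` with
`‖M − D‖ = O(ε³)`. -/
theorem exists_point_on_circle_and_surface_near_D
    (Ω : Set (ℝ × ℝ)) (hΩ : IsOpen Ω) (f : ℝ × ℝ → E3)
    (hf : ContDiffOn ℝ (⊤ : ℕ∞) f Ω)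
    (hindep : ∀ p ∈ Ω, LinearIndependent ℝ ![pd1 f p, pd2 f p])
    (horth : ∀ p ∈ Ω, dot3 (pd1 f p) (pd2 f p) = 0)
    (hconj : ∀ p ∈ Ω, pd2 (pd1 f) p ∈ Submodule.span ℝ ({pd1 f p, pd2 f p} : Set E3))
    (u₀ v₀ : ℝ) (h₀ : (u₀, v₀) ∈ Ω)
    (humb : princCurv1 f (u₀, v₀) ≠ princCurv2 f (u₀, v₀)) :
    ∃ C₀ > (0 : ℝ), ∃ ε₀ > (0 : ℝ), ∀ ε : ℝ, 0 < ε → ε < ε₀ →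
      ∃ h : AffineIndependent ℝ ![f (u₀, v₀), f (u₀ + ε, v₀), f (u₀, v₀ + ε)],
        ∃ M : E3,
          M ∈ circleThrough (f (u₀, v₀)) (f (u₀ + ε, v₀)) (f (u₀, v₀ + ε)) h ∧
          M ∈ f '' Ω ∧
          ‖M - f (u₀ + ε, v₀ + ε)‖ ≤ C₀ * ε ^ 3 := by
  obtain ⟨hw, hr, hPY, hQX⟩ := curvature_line_relations hΩ hf horth hconj h₀
  have hXY := horth _ h₀
  have hX : pd1 f (u₀, v₀) ≠ 0 := (hindep _ h₀).ne_zero 0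
  have hY : pd2 f (u₀, v₀) ≠ 0 := (hindep _ h₀).ne_zero 1
  have hne := det3_smul_norm_ne_of_princCurv_ne hX hY humb
  obtain ⟨δ₁, hδ₁, K, hexp⟩ := exists_quad_expansion hΩ hf h₀
  obtain ⟨δ₂, hδ₂, L, hL, hball, hLip, hinc⟩ := exists_increment_bound hΩ hf h₀
  set p : ℝ × ℝ := (u₀, v₀) with hp
  set X := pd1 f p
  set Y := pd2 f p
  set P := pd1 (pd1 f) p
  set Q := pd2 (pd2 f) p
  set w := pd2 (pd1 f) p
  set r := (1 / 2 : ℝ) • (pd2 (pd1 (pd1 f)) p + pd2 (pd2 (pd1 f)) p)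
  set κ := ‖X‖ ^ 2 * ‖Y‖ ^ 2 with hκ
  have hX' : 0 < ‖X‖ := norm_pos_iff.2 hX
  have hY' : 0 < ‖Y‖ := norm_pos_iff.2 hY
  have hκ0 : 0 < κ := by positivity
  have hdet : det3 X Y P / 2 * (κ * ‖Y‖ ^ 2) - det3 X Y Q / 2 * (κ * ‖X‖ ^ 2) ≠ 0 := by
    have : det3 X Y P / 2 * (κ * ‖Y‖ ^ 2) - det3 X Y Q / 2 * (κ * ‖X‖ ^ 2) =
        κ / 2 * (det3 X Y P * ‖Y‖ ^ 2 - det3 X Y Q * ‖X‖ ^ 2) := by ring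
    rw [this]
    exact mul_ne_zero (by positivity) (sub_ne_zero.2 hne)
  obtain ⟨K₁, hK₁⟩ := det3_diagonal_bound X Y P Q w r hw hr K
  obtain ⟨K₂, hK₂⟩ := circlePower_diagonal_bound X Y P Q w r hXY hPY hQX K
  obtain ⟨R, hR, η, hη, hsolve⟩ := exists_zero_of_approx_linear hdet (max K₁ K₂)
  set K₃ := ‖X‖ + ‖Y‖ + ‖P‖ + ‖Q‖ + ‖w‖ + ‖r‖ + 3 * K + L * R with hK₃
  obtain ⟨K₄, hK₄⟩ := det3_increment_bound X Y P Q w hw K₃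
  obtain ⟨K₅, hK₅⟩ := circlePower_increment_bound X Y hXY K₃
  refine ⟨L * R + 1, by positivity, min 1 (min δ₁ (min (δ₂ / (1 + R))
    (min (η / (|K₄| + |K₅| + 1)) (κ / (|K₅| + 1))))), by positivity, fun ε h0 hε => ?_⟩
  simp only [lt_min_iff] at hε
  obtain ⟨hε1, hεδ₁, hεδ₂, hεη, hεκ⟩ := hε
  rw [lt_div_iff₀ (by positivity)] at hεδ₂ hεη hεκ
  obtain ⟨b₂, c₂, e₃, k₁, k₂, hb₂, hc₂, he₃, hk₁, hk₂, b, c, hb, hc, hB, hC, hD, hU, hW⟩ :=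
    hexp ε h0 hεδ₁.le
  have hK : 0 ≤ K := (norm_nonneg _).trans hb₂
  have hq : p + ε • ((1, 1) : ℝ × ℝ) = (u₀ + ε, v₀ + ε) := by simp [hp]
  have hpB : p + ε • ((1, 0) : ℝ × ℝ) = (u₀ + ε, v₀) := by simp [hp]
  have hpC : p + ε • ((0, 1) : ℝ × ℝ) = (u₀, v₀ + ε) := by simp [hp]
  rw [hq] at hD hU hW
  rw [hpB] at hB
  rw [hpC] at hC
  set q : ℝ × ℝ := (u₀ + ε, v₀ + ε) with hqdef
  have hε2 : ε ^ 2 ≤ ε := by nlinarith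
  have hε3 : ε ^ 3 ≤ ε ^ 2 := pow_le_pow_of_le_one h0.le hε1.le (by norm_num)
  have hsub : closedBall q (ε ^ 3 * R) ⊆ ball p δ₂ := by
    intro y hy
    rw [mem_closedBall] at hy
    rw [mem_ball]
    have hqp : dist q p ≤ ε := by
      rw [← hq, dist_eq_norm, add_sub_cancel_left]
      simp [abs_of_pos h0]
    have : ε ^ 3 * R ≤ ε * R := by gcongr; linarith
    linarith [dist_triangle y q p]
  have hmem : ∀ x ∈ closedBall (0 : ℝ × ℝ) R, q + ε ^ 3 • x ∈ closedBall q (ε ^ 3 * R) := by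
    intro x hx
    rw [mem_closedBall_zero_iff] at hx
    rw [mem_closedBall, dist_eq_norm, add_sub_cancel_left, norm_smul,
      Real.norm_of_nonneg (by positivity)]
    gcongr
  have h0mem : (0 : ℝ × ℝ) ∈ closedBall (0 : ℝ × ℝ) R := mem_closedBall_self hR.le
  let m : ℝ × ℝ → E3 := fun x => ε⁻¹ • (f (q + ε ^ 3 • x) - f p)
  have hm : ∀ x, f (q + ε ^ 3 • x) - f p = ε • m x := fun x => by
    simp only [m]; rw [smul_inv_smul₀ h0.ne']
  have hm0 : m 0 = b + c + ε • (w + ε • (r + ε • e₃)) := by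
    simp only [m, smul_zero, add_zero]
    rw [hD, inv_smul_smul₀ h0.ne']
  have hdist : ∀ x ∈ closedBall (0 : ℝ × ℝ) R,
      ‖f (q + ε ^ 3 • x) - f q‖ ≤ L * R * ε ^ 3 := by
    intro x hx
    have h1 := hLip _ (hsub (hmem x hx)) _ (hsub (hmem 0 h0mem))
    rw [smul_zero, add_zero, add_sub_cancel_left, norm_smul,
      Real.norm_of_nonneg (by positivity)] at h1
    rw [mem_closedBall_zero_iff] at hx
    calc _ ≤ _ := h1
      _ ≤ L * (ε ^ 3 * R) := by gcongr
      _ = _ := by ring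
  have hsm : ∀ v : E3, ‖ε • v‖ = ε * ‖v‖ := fun v => by
    rw [norm_smul, Real.norm_of_nonneg h0.le]
  have hsm' : ∀ v : E3, ‖ε • v‖ ≤ ‖v‖ := fun v => by
    rw [hsm]; nlinarith [norm_nonneg v]
  have hhalf : ∀ v : E3, ‖(1 / 2 : ℝ) • v‖ ≤ ‖v‖ := fun v => by
    rw [norm_smul, Real.norm_of_nonneg (by norm_num)]; linarith [norm_nonneg v]
  have nP := norm_nonneg P
  have nQ := norm_nonneg Q
  have nw := norm_nonneg w
  have nr := norm_nonneg r
  have nLR : 0 ≤ L * R := by positivity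
  have hbX : ‖b - X‖ ≤ ε * (‖P‖ + K) := by
    rw [hb, add_sub_cancel_left, hsm]
    gcongr
    exact (norm_add_le _ _).trans (add_le_add (hhalf P) ((hsm' _).trans hb₂))
  have hcY : ‖c - Y‖ ≤ ε * (‖Q‖ + K) := by
    rw [hc, add_sub_cancel_left, hsm]
    gcongr
    exact (norm_add_le _ _).trans (add_le_add (hhalf Q) ((hsm' _).trans hc₂))
  have hUX : ‖pd1 f q - X‖ ≤ ε * (‖P‖ + ‖w‖ + K) := by
    rw [hU, add_sub_cancel_left, hsm]
    gcongr
    exact (norm_add_le _ _).trans (add_le_add (norm_add_le _ _) ((hsm' _).trans hk₁))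
  have hWY : ‖pd2 f q - Y‖ ≤ ε * (‖Q‖ + ‖w‖ + K) := by
    rw [hW, add_sub_cancel_left, hsm]
    gcongr
    exact (norm_add_le _ _).trans (add_le_add (norm_add_le _ _) ((hsm' _).trans hk₂))
  have hmXY : ∀ x ∈ closedBall (0 : ℝ × ℝ) R, ‖m x - (X + Y)‖ ≤ K₃ * ε := by
    intro x hx
    have e1 : ‖m x - m 0‖ ≤ L * R * ε := by
      have : m x - m 0 = ε⁻¹ • (f (q + ε ^ 3 • x) - f q) := by
        simp only [m, smul_zero, add_zero]; module
      rw [this, norm_smul, norm_inv, Real.norm_of_nonneg h0.le, inv_mul_le_iff₀ h0]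
      calc _ ≤ _ := hdist x hx
        _ ≤ L * R * ε ^ 2 := by gcongr
        _ = _ := by ring
    have e2 : ‖ε • (w + ε • (r + ε • e₃))‖ ≤ ε * (‖w‖ + (‖r‖ + K)) := by
      rw [hsm]
      gcongr
      refine (norm_add_le _ _).trans (add_le_add le_rfl ((hsm' _).trans ?_))
      exact (norm_add_le _ _).trans (add_le_add le_rfl ((hsm' _).trans he₃))
    have : m x - (X + Y) =
        (m x - m 0) + ((b - X) + (c - Y) + ε • (w + ε • (r + ε • e₃))) := by
      rw [hm0]; abel
    rw [this]
    have t1 := norm_add_le (m x - m 0) ((b - X) + (c - Y) + ε • (w + ε • (r + ε • e₃)))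
    have t2 := norm_add₃_le (a := b - X) (b := c - Y) (c := ε • (w + ε • (r + ε • e₃)))
    have t3 : 0 ≤ ε * (‖X‖ + ‖Y‖) := by positivity
    rw [hK₃]
    linarith
  have hK₃0 : 0 ≤ K₃ := by positivity
  have hbK : ‖b‖ ≤ K₃ := by
    have : ‖b‖ ≤ ‖X‖ + ‖b - X‖ := by simpa using norm_add_le X (b - X)
    have : ε * (‖P‖ + K) ≤ 1 * (‖P‖ + K) := by gcongr
    linarith
  have hcK : ‖c‖ ≤ K₃ := by
    have : ‖c‖ ≤ ‖Y‖ + ‖c - Y‖ := by simpa using norm_add_le Y (c - Y)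
    have : ε * (‖Q‖ + K) ≤ 1 * (‖Q‖ + K) := by gcongr
    linarith
  have hKK₃ : K ≤ K₃ := by linarith
  have hto : ∀ {s t : ℝ}, s ≤ ε * t → t ≤ K₃ → s ≤ K₃ * ε := fun h1 h2 =>
    h1.trans (by rw [mul_comm]; gcongr)
  have hbX' := hto hbX (by linarith)
  have hcY' := hto hcY (by linarith)
  have hUX' := hto hUX (by linarith)
  have hWY' := hto hWY (by linarith)
  have hgram : 0 < gram b c := by
    have h1 := (hK₅ ε h0 hε1.le b c _ _ (m 0) (m 0) 0 hbX' hcY' hUX' hWY' (hmXY 0 h0mem)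
      (hmXY 0 h0mem)).1
    have h2 := (abs_le.1 h1).1
    have h3 : K₅ * ε ≤ |K₅| * ε := by gcongr; exact le_abs_self _
    linarith
  obtain ⟨x, hx, hx0⟩ := hsolve
    (fun x => (det3 b c (m x) / ε ^ 3, circlePower b c (m x) / ε ^ 2))
    (by
      rw [Prod.norm_def]
      refine max_le_max ?_ ?_
      · rw [Real.norm_eq_abs, abs_div, abs_of_pos (by positivity : 0 < ε ^ 3),
          div_le_iff₀ (by positivity)]
        exact hK₁ ε h0.le hε1.le b₂ c₂ e₃ hb₂ hc₂ he₃ b c _ hb hc hm0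
      · rw [Real.norm_eq_abs, abs_div, abs_of_pos (by positivity : 0 < ε ^ 2),
          div_le_iff₀ (by positivity)]
        exact hK₂ ε h0.le hε1.le b₂ c₂ e₃ hb₂ hc₂ he₃ b c _ hb hc hm0)
    (by
      intro x hx y hy
      have hd₁ : |(x - y).1| ≤ ‖x - y‖ := norm_fst_le (x - y)
      have hd₂ : |(x - y).2| ≤ ‖x - y‖ := norm_snd_le (x - y)
      set ζ := f (q + ε ^ 3 • x) - f (q + ε ^ 3 • y) -
        fderiv ℝ f q ((q + ε ^ 3 • x) - (q + ε ^ 3 • y)) with hζ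
      have hζn : ‖ζ‖ ≤ L * (ε ^ 3 * R) * (ε ^ 3 * ‖x - y‖) := by
        have h1 := hinc q (ε ^ 3 * R) hsub _ (hmem x hx) _ (hmem y hy)
        have h2 : ‖(q + ε ^ 3 • x) - (q + ε ^ 3 • y)‖ = ε ^ 3 * ‖x - y‖ := by
          rw [add_sub_add_left_eq_sub, ← smul_sub, norm_smul, Real.norm_of_nonneg (by positivity)]
        rwa [h2] at h1
      have hσ : ‖(ε ^ 3)⁻¹ • ζ‖ ≤ L * R * ε ^ 3 * ‖x - y‖ := by
        rw [norm_smul, norm_inv, Real.norm_of_nonneg (by positivity : 0 ≤ ε ^ 3),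
          inv_mul_le_iff₀ (by positivity)]
        linarith
      have hσ' : ‖(ε ^ 3)⁻¹ • ζ‖ ≤ K₃ * ε ^ 2 * ‖x - y‖ := hσ.trans (by gcongr; linarith)
      have hmm : m x - m y = ε ^ 2 • ((x - y).1 • pd1 f q + (x - y).2 • pd2 f q +
          (ε ^ 3)⁻¹ • ζ) := by
        have h1 : fderiv ℝ f q ((q + ε ^ 3 • x) - (q + ε ^ 3 • y)) =
            ε ^ 3 • ((x - y).1 • pd1 f q + (x - y).2 • pd2 f q) := by
          rw [add_sub_add_left_eq_sub, ← smul_sub, map_smul, fderiv_eq_pd]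
        have h2 : f (q + ε ^ 3 • x) - f (q + ε ^ 3 • y) =
            ε ^ 3 • ((x - y).1 • pd1 f q + (x - y).2 • pd2 f q + (ε ^ 3)⁻¹ • ζ) := by
          rw [smul_add, smul_inv_smul₀ (by positivity), ← h1, hζ]; abel
        have h3 : m x - m y = ε⁻¹ • (f (q + ε ^ 3 • x) - f (q + ε ^ 3 • y)) := by
          simp only [m]; module
        rw [h3, h2, smul_smul]
        congr 1
        field_simp
      have hη' : ∀ t : ℝ, t ≤ |K₄| + |K₅| + 1 → t * ε * ‖x - y‖ ≤ η * ‖x - y‖ := by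
        intro t ht
        gcongr
        nlinarith
      constructor
      · refine (hK₄ ε h0 hε1.le b₂ c₂ k₁ k₂ (hb₂.trans hKK₃) (hc₂.trans hKK₃) (hk₁.trans hKK₃)
          (hk₂.trans hKK₃) b c _ _ hb hc hU hW hbK hcK _ _ _ _ _ _ hd₁ hd₂ hσ' hmm).trans
          (hη' _ ?_)
        linarith [le_abs_self K₄, abs_nonneg K₅]
      · refine ((hK₅ ε h0 hε1.le b c _ _ _ _ _ hbX' hcY' hUX' hWY' (hmXY x hx) (hmXY y hy)).2
          _ _ _ hd₁ hd₂ (hσ'.trans (by gcongr)) hmm).trans (hη' _ ?_)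
        linarith [le_abs_self K₅, abs_nonneg K₄])
  rw [Prod.mk_eq_zero, div_eq_zero_iff, div_eq_zero_iff] at hx0
  have hx1 := hx0.1.resolve_right (by positivity)
  have hx2 := hx0.2.resolve_right (by positivity)
  have hG : gram (f (u₀ + ε, v₀) - f p) (f (u₀, v₀ + ε) - f p) ≠ 0 := by
    rw [hB, hC, gram_smul]; positivity
  have haff := affineIndependent_of_gram_ne_zero hG
  refine ⟨haff, f (q + ε ^ 3 • x), mem_circleThrough hG ?_ ?_ haff,
    ⟨_, hball (hsub (hmem x hx)), rfl⟩, (hdist x hx).trans ?_⟩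
  · rw [hB, hC, hm, det3_smul, hx1, mul_zero]
  · rw [hB, hC, hm, circlePower_smul, hx2, mul_zero]
  · gcongr
    linarith

end
end
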